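/- There exists a constant C > 0 such that for every graph G with pair-crossing number p = pcr(G) ≥ 2, the crossing number satisfies cr(G) ≤ C·p^{3/2}·(log p)². -/

import Mathlib

open Finset

/-- A curve from `x` to `y`: the image of a continuous map `[0,1] → ℝ²`
with prescribed endpoints. -/
def IsArc (c : Set (ℝ × ℝ)) (x y : ℝ × ℝ) : Prop :=
  ∃ f : ℝ → ℝ × ℝ, ContinuousOn f (Set.Icc 0 1) ∧ c = f '' Set.Icc 0 1 ∧
    f 0 = x ∧ f 1 = y

/-- A curve: the image of a continuous map `[0,1] → ℝ²`. -/
def IsCurve (c : Set (ℝ × ℝ)) : Prop := ∃ x y, IsArc c x y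

/-- `G` is a string graph: an intersection graph of curves in the plane. -/
def SimpleGraph.IsStringGraph {V : Type*} (G : SimpleGraph V) : Prop :=
  ∃ γ : V → Set (ℝ × ℝ), (∀ v, IsCurve (γ v)) ∧
    ∀ u v : V, (γ u ∩ γ v).Nonempty ↔ (G.Adj u v ∨ u = v)

section Drawings

variable {V : Type*} (G : SimpleGraph V)

/-- A drawing of a graph `G` in the plane: vertices are represented by distinct
points, each edge by a curve joining the points of its endpoints, no edge passes
through the point of a vertex other than its endpoints, and any two distinct edges
share only finitely many points. -/
structure SimpleGraph.Drawing where
  pt : V → ℝ × ℝ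
  pt_inj : Function.Injective pt
  arc : G.edgeSet → Set (ℝ × ℝ)
  arc_isArc : ∀ e : G.edgeSet, ∃ u v : V, (e : Sym2 V) = s(u, v) ∧
    IsArc (arc e) (pt u) (pt v)
  arc_vertex : ∀ (e : G.edgeSet) (w : V), pt w ∈ arc e → w ∈ (e : Sym2 V)
  arc_finite : ∀ e e' : G.edgeSet, e ≠ e' → (arc e ∩ arc e').Finite

/-- The set of crossings between (the arcs of) two edges in a drawing: common
points that are not points of shared endpoints. -/
def SimpleGraph.Drawing.crossSet {G : SimpleGraph V} (D : G.Drawing)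
    (e e' : G.edgeSet) : Set (ℝ × ℝ) :=
  (D.arc e ∩ D.arc e') \ {x | ∃ w : V, D.pt w = x ∧ w ∈ (e : Sym2 V) ∧ w ∈ (e' : Sym2 V)}

/-- The number of unordered pairs of edges that cross in a drawing. -/
noncomputable def SimpleGraph.Drawing.crossingPairCount {G : SimpleGraph V}
    (D : G.Drawing) : ℕ :=
  Nat.card {p : G.edgeSet × G.edgeSet // p.1 ≠ p.2 ∧ (D.crossSet p.1 p.2).Nonempty} / 2

/-- The total number of crossings in a drawing. -/
noncomputable def SimpleGraph.Drawing.crossingCount {G : SimpleGraph V}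
    (D : G.Drawing) : ℕ :=
  (∑ᶠ (e : G.edgeSet) (e' : G.edgeSet) (_ : e ≠ e'), (D.crossSet e e').ncard) / 2

/-- The pair-crossing number of `G`. -/
noncomputable def SimpleGraph.pcr : ℕ :=
  sInf { k : ℕ | ∃ D : G.Drawing, D.crossingPairCount = k }

/-- The crossing number of `G`. -/
noncomputable def SimpleGraph.cr : ℕ :=
  sInf { k : ℕ | ∃ D : G.Drawing, D.crossingCount = k }

end Drawings



/-- The grid graph on `ℤ × ℤ`. -/
def gridG : SimpleGraph (ℤ × ℤ) where
  Adj a b := (a.1 = b.1 ∧ (a.2 = b.2 + 1 ∨ b.2 = a.2 + 1)) ∨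
    (a.2 = b.2 ∧ (a.1 = b.1 + 1 ∨ b.1 = a.1 + 1))
  symm := ⟨by intro a b h; omega⟩
  loopless := ⟨by intro a h; omega⟩

namespace K5aux

/-- ray crossing indicator -/
def st (u v c : ℤ × ℤ) : ZMod 2 :=
  if u.1 = v.1 ∧ min u.2 v.2 = c.2 ∧ u.1 < c.1 then 1 else 0

/-- order indicator -/
def od (x d : ℤ × ℤ) : ZMod 2 :=
  if x.2 < d.2 ∨ (x.2 = d.2 ∧ x.1 < d.1) then 1 else 0

/-- parity of ray crossings -/
def wc : {a b : ℤ × ℤ} → gridG.Walk a b → (ℤ × ℤ) → ZMod 2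
  | _, _, .nil, _ => 0
  | a, _, .cons (v := v) _ p, c => st a v c + wc p c

lemma st_symm {u v : ℤ × ℤ} (c) : st u v c = st v u c := by
  unfold st
  congr 1
  simp only [eq_iff_iff]
  omega

lemma od_add {x y : ℤ × ℤ} (h : x ≠ y) : od x y + od y x = 1 := by
  unfold od
  have : ¬ (x.1 = y.1 ∧ x.2 = y.2) := fun ⟨h1, h2⟩ => h (Prod.ext h1 h2)
  split_ifs <;> first | omega | decide

lemma base_aux {a a' d d' : ℤ × ℤ}
    (ha : (a'.1 = a.1 ∧ a'.2 = a.2 + 1) ∨ (a'.2 = a.2 ∧ a'.1 = a.1 + 1))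
    (hd : (d'.1 = d.1 ∧ d'.2 = d.2 + 1) ∨ (d'.2 = d.2 ∧ d'.1 = d.1 + 1))
    (h1 : a ≠ d) (h2 : a ≠ d') (h3 : a' ≠ d) (h4 : a' ≠ d') :
    st a a' d + st a a' d' + st d d' a + st d d' a' =
      od a d + od a d' + od a' d + od a' d' := by
  obtain ⟨x, y⟩ := a
  obtain ⟨x', y'⟩ := a'
  obtain ⟨z, t⟩ := d
  obtain ⟨z', t'⟩ := d'
  simp only [ne_eq, Prod.mk.injEq, st, od] at *
  have m1 : min y (y+1) = y := by omega
  have m2 : min t (t+1) = t := by omega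
  rcases ha with ⟨ha, ha'⟩ | ⟨ha, ha'⟩ <;> rcases hd with ⟨hd, hd'⟩ | ⟨hd, hd'⟩ <;> subst ha ha' hd hd' <;>
    simp only [m1, m2, min_self, true_and, left_eq_add, one_ne_zero, false_and, if_false]
  · rcases lt_trichotomy x' z' with g | g | g
    · simp only [g, g.ne, and_true, and_false, not_lt_of_gt g, or_false, if_false]
      split_ifs <;> first | omega | decide
    · simp only [g, lt_irrefl, and_false, or_false, if_false]
      split_ifs <;> first | omega | decide
    · simp only [g, g.ne', and_true, and_false, not_lt_of_gt g, or_false, if_false]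
      split_ifs <;> first | omega | decide
  · split_ifs <;> first | omega | decide
  · split_ifs <;> first | omega | decide
  · split_ifs <;> first | omega | decide

lemma base {a a' d d' : ℤ × ℤ} (ha : gridG.Adj a a') (hd : gridG.Adj d d')
    (h1 : a ≠ d) (h2 : a ≠ d') (h3 : a' ≠ d) (h4 : a' ≠ d') :
    st a a' d + st a a' d' + st d d' a + st d d' a' =
      od a d + od a d' + od a' d + od a' d' := by
  have key : ∀ {a b : ℤ × ℤ}, gridG.Adj a b →
    ((b.1 = a.1 ∧ b.2 = a.2 + 1) ∨ (b.2 = a.2 ∧ b.1 = a.1 + 1)) ∨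
    ((a.1 = b.1 ∧ a.2 = b.2 + 1) ∨ (a.2 = b.2 ∧ a.1 = b.1 + 1)) := by
    intro a b h
    change (a.1 = b.1 ∧ (a.2 = b.2 + 1 ∨ b.2 = a.2 + 1)) ∨
      (a.2 = b.2 ∧ (a.1 = b.1 + 1 ∨ b.1 = a.1 + 1)) at h
    omega
  rcases key ha with ha | ha <;> rcases key hd with hd | hd
  · exact base_aux ha hd h1 h2 h3 h4
  · have := base_aux ha hd h2 h1 h4 h3
    rw [st_symm (u := d)  (v := d') a, st_symm (u := d) (v := d') a']
    linear_combination this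
  · have := base_aux ha hd h3 h4 h1 h2
    rw [st_symm (u := a) (v := a') d, st_symm (u := a) (v := a') d']
    linear_combination this
  · have := base_aux ha hd h4 h3 h2 h1
    rw [st_symm (u := a) (v := a') d, st_symm (u := a) (v := a') d',
      st_symm (u := d) (v := d') a, st_symm (u := d) (v := d') a']
    linear_combination this

lemma two0 : (2 : ZMod 2) = 0 := rfl

lemma step1 {a b d d' : ℤ × ℤ} (P : gridG.Walk a b) (hd : gridG.Adj d d')
    (h1 : d ∉ P.support) (h2 : d' ∉ P.support) :
    wc P d + wc P d' + st d d' a + st d d' b = od a d + od a d' + od b d + od b d' := by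
  induction P with
  | nil =>
    simp only [wc]
    linear_combination (st d d' _ - od _ d - od _ d') * two0
  | @cons u v w h p ih =>
    simp only [SimpleGraph.Walk.support_cons, List.mem_cons, not_or] at h1 h2
    have i := ih h1.2 h2.2
    have hv : v ∈ p.support := p.start_mem_support
    have bs := base (a := u) (a' := v) h hd (Ne.symm h1.1) (Ne.symm h2.1)
      (fun e => h1.2 (e ▸ hv)) (fun e => h2.2 (e ▸ hv))
    simp only [wc]
    linear_combination i + bs + (od v d + od v d' - st d d' v) * two0

lemma step2 {a b c d : ℤ × ℤ} (P : gridG.Walk a b) (Q : gridG.Walk c d)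
    (h : ∀ x ∈ P.support, x ∉ Q.support) :
    wc P c + wc P d + wc Q a + wc Q b = od a c + od a d + od b c + od b d := by
  induction Q with
  | nil =>
    simp only [wc]
    linear_combination (wc P _ - od a _ - od b _) * two0
  | @cons u v w hh q ih =>
    simp only [SimpleGraph.Walk.support_cons, List.mem_cons, not_or] at h
    have i := ih (fun x hx => (h x hx).2)
    have s := step1 P hh (fun hu => (h _ hu).1 rfl) (fun hv => (h _ hv).2 q.start_mem_support)
    simp only [wc]
    linear_combination i + s + (od a v + od b v - wc P v) * two0

end K5aux

open K5aux in
/-- Among ten walks joining five lattice points two independent ones meet. -/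
theorem grid_K5 (v : Fin 5 → ℤ × ℤ) (P : ∀ i j, gridG.Walk (v i) (v j)) :
    ∃ i j k l : Fin 5, i ≠ j ∧ i ≠ k ∧ i ≠ l ∧ j ≠ k ∧ j ≠ l ∧ k ≠ l ∧
      ∃ x ∈ (P i j).support, x ∈ (P k l).support := by
  by_contra! hcon
  have hne : ∀ i j : Fin 5, i ≠ j → v i ≠ v j := by
    intro i j hij h
    have hd : ∀ i j : Fin 5, ∃ k l : Fin 5, i ≠ k ∧ i ≠ l ∧ j ≠ k ∧ j ≠ l ∧ k ≠ l := by decide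
    obtain ⟨k, l, h1, h2, h3, h4, h5⟩ := hd i j
    exact hcon i k j l h1 hij h2 (Ne.symm h3) h5 h4 (v i) (P i k).start_mem_support
      (by rw [h]; exact (P j l).start_mem_support)
  have E : ∀ i j k l : Fin 5, i ≠ j → i ≠ k → i ≠ l → j ≠ k → j ≠ l → k ≠ l → _ :=
    fun i j k l h1 h2 h3 h4 h5 h6 => step2 (P i j) (P k l) (hcon i j k l h1 h2 h3 h4 h5 h6)
  have O : ∀ i j : Fin 5, i ≠ j → od (v j) (v i) = 1 + od (v i) (v j) := by
    intro i j h
    have := od_add (hne i j h)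
    linear_combination this - od (v i) (v j) * two0
  have e1 := E 0 1 2 3 (by decide) (by decide) (by decide) (by decide) (by decide) (by decide)
  have e2 := E 0 2 1 3 (by decide) (by decide) (by decide) (by decide) (by decide) (by decide)
  have e3 := E 0 3 1 2 (by decide) (by decide) (by decide) (by decide) (by decide) (by decide)
  have e4 := E 0 1 2 4 (by decide) (by decide) (by decide) (by decide) (by decide) (by decide)
  have e5 := E 0 2 1 4 (by decide) (by decide) (by decide) (by decide) (by decide) (by decide)
  have e6 := E 0 4 1 2 (by decide) (by decide) (by decide) (by decide) (by decide) (by decide)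
  have e7 := E 0 1 3 4 (by decide) (by decide) (by decide) (by decide) (by decide) (by decide)
  have e8 := E 0 3 1 4 (by decide) (by decide) (by decide) (by decide) (by decide) (by decide)
  have e9 := E 0 4 1 3 (by decide) (by decide) (by decide) (by decide) (by decide) (by decide)
  have e10 := E 0 2 3 4 (by decide) (by decide) (by decide) (by decide) (by decide) (by decide)
  have e11 := E 0 3 2 4 (by decide) (by decide) (by decide) (by decide) (by decide) (by decide)
  have e12 := E 0 4 2 3 (by decide) (by decide) (by decide) (by decide) (by decide) (by decide)
  have e13 := E 1 2 3 4 (by decide) (by decide) (by decide) (by decide) (by decide) (by decide)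
  have e14 := E 1 3 2 4 (by decide) (by decide) (by decide) (by decide) (by decide) (by decide)
  have e15 := E 1 4 2 3 (by decide) (by decide) (by decide) (by decide) (by decide) (by decide)
  have S : ∀ {x y z w : ZMod 2}, x = y → z = w → x + z = y + w := fun h1 h2 => by rw [h1, h2]
  have e := S (S (S (S e1 e2) (S e3 e4)) (S (S e5 e6) (S e7 e8)))
    (S (S (S e9 e10) (S e11 e12)) (S (S e13 e14) e15))
  simp only [O 1 2 (by decide), O 1 3 (by decide), O 1 4 (by decide), O 2 3 (by decide),
    O 2 4 (by decide), O 3 4 (by decide)] at e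
  ring_nf at e
  reduce_mod_char at e
  exact absurd e (by decide)


/-- connectivity of a finite set with respect to a relation -/
def TConn {E : Type*} (τ : E → E → Prop) (U : Finset E) : Prop :=
  ∀ a ∈ U, ∀ b ∈ U, Relation.ReflTransGen (fun x y => x ∈ U ∧ y ∈ U ∧ τ x y) a b

/-- no five branch sets can be joined in a `K5` like manner without touching -/
def K5Prop {E : Type*} (τ : E → E → Prop) : Prop :=
  ∀ (v : Fin 5 → E) (U : Fin 5 → Fin 5 → Finset E),
    (∀ i j, TConn τ (U i j) ∧ v i ∈ U i j ∧ v j ∈ U i j) →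
    ∃ i j k l : Fin 5, i ≠ j ∧ i ≠ k ∧ i ≠ l ∧ j ≠ k ∧ j ≠ l ∧ k ≠ l ∧
      ∃ x ∈ U i j, ∃ y ∈ U k l, τ x y

/-- a routing system inside `X` -/
def ValidSys {E : Type*} (τ : E → E → Prop) (X : Finset E) (π : E → E → Finset E) : Prop :=
  ∀ s ∈ X, ∀ t ∈ X, π s t ⊆ X ∧ TConn τ (π s t) ∧ s ∈ π s t ∧ t ∈ π s t

lemma marginal {I J β : Type*} [Fintype I] [Fintype J] [Fintype β] [DecidableEq I]
    [DecidableEq J] [DecidableEq β]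
    (ι : J → I) (hι : Function.Injective ι) (w : β → ℝ) (hw : ∑ b, w b = 1)
    (G : (J → β) → ℝ) :
    ∑ ω : I → β, (∏ i, w (ω i)) * G (ω ∘ ι) = ∑ x : J → β, (∏ j, w (x j)) * G x := by
  classical
  have h1 : ∀ ω : I → β, (∏ i, w (ω i)) * G (ω ∘ ι) =
      ∑ x : J → β, (if ω ∘ ι = x then ∏ i, w (ω i) else 0) * G x := by
    intro ω
    simp [ite_mul]
  simp_rw [h1]
  rw [Finset.sum_comm]
  refine Finset.sum_congr rfl fun x _ => ?_
  rw [← Finset.sum_mul]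
  congr 1
  have h2 : ∀ ω : I → β, (if ω ∘ ι = x then ∏ i, w (ω i) else 0) =
      ∏ i, (if ∀ j, ι j = i → ω i = x j then w (ω i) else 0) := by
    intro ω
    by_cases h : ω ∘ ι = x
    · rw [if_pos h]
      refine Finset.prod_congr rfl fun i _ => ?_
      rw [if_pos]
      rintro j rfl
      rw [← h]; rfl
    · rw [if_neg h]
      obtain ⟨j, hj⟩ : ∃ j, ω (ι j) ≠ x j := by
        by_contra! hc
        exact h (funext hc)
      symm
      apply Finset.prod_eq_zero (mem_univ (ι j))
      rw [if_neg]
      exact fun hh => hj (hh j rfl)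
  simp_rw [h2]
  have h3 := (Finset.prod_univ_sum (fun _ : I => (univ : Finset β))
    (fun i b => if ∀ j, ι j = i → b = x j then w b else 0))
  rw [Fintype.piFinset_univ] at h3
  rw [← h3]
  symm
  apply Fintype.prod_of_injective ι hι
  · intro i hi
    rw [← hw]
    refine Finset.sum_congr rfl fun b _ => ?_
    rw [if_pos]
    rintro j rfl
    exact absurd ⟨j, rfl⟩ hi
  · intro j
    rw [Finset.sum_eq_single (x j)]
    · rw [if_pos]
      intro j' hj'
      rw [hι hj']
    · intro b _ hb
      rw [if_neg]
      exact fun h => hb (h j rfl)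
    · simp

section flow
variable {E : Type*} [Fintype E] [DecidableEq E] (τ : E → E → Prop)

open Classical in
/-- the crossing indicator of two sets -/
noncomputable def tInd (A B : Finset E) : ℝ := if ∃ x ∈ A, ∃ y ∈ B, τ x y then 1 else 0

lemma tInd_nonneg (A B : Finset E) : 0 ≤ tInd τ A B := by
  unfold tInd; split_ifs <;> norm_num

open Classical in
lemma tInd_le (X A B : Finset E) (hA : A ⊆ X) (hB : B ⊆ X) :
    tInd τ A B ≤ ∑ u ∈ X, ∑ y ∈ X, (if τ u y then (1:ℝ) else 0) *
      ((if u ∈ A then 1 else 0) * (if y ∈ B then 1 else 0)) := by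
  unfold tInd
  split_ifs with h
  · obtain ⟨x, hx, y, hy, hxy⟩ := h
    have h0 : ∀ u ∈ X, (0:ℝ) ≤ ∑ y ∈ X, (if τ u y then (1:ℝ) else 0) *
      ((if u ∈ A then 1 else 0) * (if y ∈ B then 1 else 0)) := by
      intros; positivity
    refine le_trans ?_ (Finset.single_le_sum h0 (hA hx))
    refine le_trans ?_ (Finset.single_le_sum (fun i _ => by positivity) (hB hy))
    simp [hx, hy, hxy]
  · positivity

abbrev Sys (X : Finset E) := {π : E → E → Finset E // ValidSys τ X π}

noncomputable instance (X : Finset E) : Fintype (Sys τ X) := Fintype.ofFinite _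

/-- five-tuples: sampling argument -/
lemma tuple_bound (hK : K5Prop τ) (X : Finset E) (w : Sys τ X → ℝ) (hw0 : ∀ π, 0 ≤ w π)
    (hw : ∑ π, w π = 1) (v : Fin 5 → E) (hv : ∀ i, v i ∈ X) :
    1 ≤ ∑ f : Fin 4 ↪ Fin 5, ∑ π : Sys τ X, ∑ π' : Sys τ X, w π * w π' *
      tInd τ (π.1 (v (f 0)) (v (f 1))) (π'.1 (v (f 2)) (v (f 3))) := by
  classical
  have key : ∀ f : Fin 4 ↪ Fin 5, ∑ π : Sys τ X, ∑ π' : Sys τ X, w π * w π' *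
      tInd τ (π.1 (v (f 0)) (v (f 1))) (π'.1 (v (f 2)) (v (f 3))) =
      ∑ ω : Fin 5 × Fin 5 → Sys τ X, (∏ i, w (ω i)) *
        tInd τ ((ω (f 0, f 1)).1 (v (f 0)) (v (f 1))) ((ω (f 2, f 3)).1 (v (f 2)) (v (f 3))) := by
    intro f
    have hinj : Function.Injective (![(f 0, f 1), (f 2, f 3)] : Fin 2 → Fin 5 × Fin 5) := by
      intro a b hab
      have : f 0 ≠ f 2 := fun h => absurd (f.injective h) (by decide)
      fin_cases a <;> fin_cases b <;> simp_all
    have := marginal _ hinj w hw (fun x : Fin 2 → Sys τ X =>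
      tInd τ ((x 0).1 (v (f 0)) (v (f 1))) ((x 1).1 (v (f 2)) (v (f 3))))
    simp only [Function.comp_def] at this
    simp only [Matrix.cons_val_zero, Matrix.cons_val_one] at this
    rw [this, ← (finTwoArrowEquiv (Sys τ X)).symm.sum_comp, Fintype.sum_prod_type]
    simp [Fin.prod_univ_two]
  simp_rw [key]
  rw [Finset.sum_comm]
  have h1 : ∑ ω : Fin 5 × Fin 5 → Sys τ X, (∏ i, w (ω i)) = 1 := by
    have h3 := (Finset.prod_univ_sum (fun _ : Fin 5 × Fin 5 => (univ : Finset (Sys τ X)))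
      (fun _ b => w b))
    rw [Fintype.piFinset_univ] at h3
    rw [← h3, Finset.prod_eq_one fun _ _ => hw]
  conv_lhs => rw [← h1]
  refine Finset.sum_le_sum fun ω _ => ?_
  rw [← Finset.mul_sum]
  refine le_mul_of_one_le_right (Finset.prod_nonneg fun _ _ => hw0 _) ?_
  obtain ⟨i, j, k, l, h1, h2, h3, h4, h5, h6, hx⟩ := hK v (fun i j => (ω (i, j)).1 (v i) (v j))
    (fun i j => ((ω (i, j)).2 _ (hv i) _ (hv j)).2)
  let f : Fin 4 ↪ Fin 5 := ⟨![i, j, k, l], by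
    intro a b hab
    fin_cases a <;> fin_cases b <;> simp_all⟩
  refine le_trans ?_ (Finset.single_le_sum (fun f _ => tInd_nonneg τ _ _) (mem_univ f))
  have : tInd τ ((ω (i, j)).1 (v i) (v j)) ((ω (k, l)).1 (v k) (v l)) = 1 := by
    unfold tInd; rw [if_pos hx]
  exact this.ge

open Classical in
lemma quad_bound (hK : K5Prop τ) (X : Finset E) (hX : X.Nonempty) (w : Sys τ X → ℝ)
    (hw0 : ∀ π, 0 ≤ w π) (hw : ∑ π, w π = 1) :
    (#X : ℝ) ^ 4 ≤ 120 * ∑ s ∈ X, ∑ t ∈ X, ∑ s' ∈ X, ∑ t' ∈ X,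
      ∑ π : Sys τ X, ∑ π' : Sys τ X, w π * w π' * tInd τ (π.1 s t) (π'.1 s' t') := by
  set P : (Fin 4 → E) → ℝ := fun x => ∑ π : Sys τ X, ∑ π' : Sys τ X, w π * w π' *
    tInd τ (π.1 (x 0) (x 1)) (π'.1 (x 2) (x 3)) with hP
  have hn : (0:ℝ) < #X := by exact_mod_cast hX.card_pos
  let μ : E → ℝ := fun e => if e ∈ X then (#X : ℝ)⁻¹ else 0
  have hμ : ∑ e, μ e = 1 := by
    simp only [μ, Finset.sum_ite_mem, Finset.univ_inter, Finset.sum_const, nsmul_eq_mul]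
    field_simp
  have hμ0 : ∀ e, 0 ≤ μ e := by
    intro e; simp only [μ]; split_ifs <;> positivity
  have h1 : (1:ℝ) ≤ ∑ f : Fin 4 ↪ Fin 5, ∑ v : Fin 5 → E, (∏ i, μ (v i)) * P (v ∘ f) := by
    rw [Finset.sum_comm]
    have h1 : ∑ v : Fin 5 → E, (∏ i, μ (v i)) = 1 := by
      have h3 := (Finset.prod_univ_sum (fun _ : Fin 5 => (univ : Finset E))
        (fun _ b => μ b))
      rw [Fintype.piFinset_univ] at h3
      rw [← h3, Finset.prod_eq_one fun _ _ => hμ]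
    conv_lhs => rw [← h1]
    refine Finset.sum_le_sum fun v _ => ?_
    rw [← Finset.mul_sum]
    by_cases hv : ∀ i, v i ∈ X
    · refine le_mul_of_one_le_right (Finset.prod_nonneg fun _ _ => hμ0 _) ?_
      exact tuple_bound τ hK X w hw0 hw v hv
    · push Not at hv
      obtain ⟨i, hi⟩ := hv
      have : ∏ i, μ (v i) = 0 := Finset.prod_eq_zero (mem_univ i) (by simp [μ, hi])
      rw [this]; simp
  simp_rw [fun f : Fin 4 ↪ Fin 5 => marginal f f.injective μ hμ P] at h1
  rw [Finset.sum_const, Finset.card_univ, Fintype.card_embedding_eq] at h1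
  have h2 : ∑ x : Fin 4 → E, (∏ j, μ (x j)) * P x =
      ((#X : ℝ)⁻¹) ^ 4 * ∑ s ∈ X, ∑ t ∈ X, ∑ s' ∈ X, ∑ t' ∈ X, P ![s, t, s', t'] := by
    have e1 : ∀ g : (Fin 4 → E) → ℝ, ∑ x, g x = ∑ a, ∑ b, ∑ c, ∑ d, g ![a, b, c, d] := by
      intro g
      have e : ∀ (m : ℕ) (g : (Fin (m+1) → E) → ℝ), ∑ x, g x =
          ∑ a, ∑ y : Fin m → E, g (Matrix.vecCons a y) := by
        intro m g
        rw [← (Fin.consEquiv (fun _ : Fin (m+1) => E)).sum_comp, Fintype.sum_prod_type]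
        rfl
      have hd : (default : Fin 0 → E) = ![] := Subsingleton.elim _ _
      simp_rw [e]
      simp [hd]
    rw [e1]
    have e2 : ∀ g : E → ℝ, ∑ a, μ a * g a = (#X : ℝ)⁻¹ * ∑ a ∈ X, g a := by
      intro g
      simp [μ, ite_mul, Finset.mul_sum]
    simp only [Fin.prod_univ_four, Matrix.cons_val_zero, Matrix.cons_val_one, Matrix.cons_val]
    simp only [mul_assoc, ← Finset.mul_sum, e2]
    ring
  rw [h2] at h1
  have h3 : (Fintype.card (Fin 5)).descFactorial (Fintype.card (Fin 4)) = 120 := by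
    simp [Nat.descFactorial]
  rw [h3, nsmul_eq_mul] at h1
  simp only [hP, Matrix.cons_val_zero, Matrix.cons_val_one, Matrix.cons_val] at h1
  set Z := ∑ s ∈ X, ∑ t ∈ X, ∑ s' ∈ X, ∑ t' ∈ X,
      ∑ π : Sys τ X, ∑ π' : Sys τ X, w π * w π' * tInd τ (π.1 s t) (π'.1 s' t')
  have : (#X : ℝ)^4 * 1 ≤ (#X : ℝ)^4 * (((120:ℕ):ℝ) * ((#X : ℝ)⁻¹ ^ 4 * Z)) := by gcongr
  calc (#X : ℝ)^4 = (#X : ℝ)^4 * 1 := by ring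
    _ ≤ _ := this
    _ = 120 * Z := by push_cast; field_simp

end flow


section flow
variable {E : Type*} [Fintype E] [DecidableEq E] (τ : E → E → Prop)

open Classical in
/-- the bilinear touching form -/
noncomputable def tBil (X : Finset E) (f g : E → ℝ) : ℝ :=
  ∑ u ∈ X, ∑ y ∈ X, (if τ u y then (1:ℝ) else 0) * (f u * g y)

lemma tBil_suml {ι : Type*} (X : Finset E) (S : Finset ι) (a : ι → ℝ) (f : ι → E → ℝ) (g : E → ℝ) :
    ∑ i ∈ S, a i * tBil τ X (f i) g = tBil τ X (fun u => ∑ i ∈ S, a i * f i u) g := by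
  unfold tBil
  simp_rw [Finset.mul_sum]
  rw [Finset.sum_comm]
  refine Finset.sum_congr rfl fun u _ => ?_
  rw [Finset.sum_comm]
  refine Finset.sum_congr rfl fun y _ => ?_
  rw [Finset.sum_mul, Finset.mul_sum]
  refine Finset.sum_congr rfl fun i _ => ?_
  ring

lemma tBil_sumr {ι : Type*} (X : Finset E) (S : Finset ι) (a : ι → ℝ) (f : ι → E → ℝ) (g : E → ℝ) :
    ∑ i ∈ S, a i * tBil τ X g (f i) = tBil τ X g (fun u => ∑ i ∈ S, a i * f i u) := by
  unfold tBil
  simp_rw [Finset.mul_sum]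
  rw [Finset.sum_comm]
  refine Finset.sum_congr rfl fun u _ => ?_
  rw [Finset.sum_comm]
  refine Finset.sum_congr rfl fun y _ => ?_
  refine Finset.sum_congr rfl fun i _ => ?_
  ring

/-- congestion -/
noncomputable def cong (X : Finset E) (π : E → E → Finset E) (u : E) : ℝ :=
  ∑ s ∈ X, ∑ t ∈ X, if u ∈ π s t then 1 else 0

/-- fractional congestion -/
noncomputable def fcong (X : Finset E) (w : Sys τ X → ℝ) (u : E) : ℝ :=
  ∑ π, w π * cong X π.1 u

lemma quad_le (X : Finset E) (w : Sys τ X → ℝ) (hw0 : ∀ π, 0 ≤ w π) :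
    ∑ s ∈ X, ∑ t ∈ X, ∑ s' ∈ X, ∑ t' ∈ X,
      ∑ π : Sys τ X, ∑ π' : Sys τ X, w π * w π' * tInd τ (π.1 s t) (π'.1 s' t') ≤
    tBil τ X (fcong τ X w) (fcong τ X w) := by
  have suml1 : ∀ (S : Finset E) (f : E → E → ℝ) (g : E → ℝ),
    ∑ i ∈ S, tBil τ X (f i) g = tBil τ X (fun u => ∑ i ∈ S, f i u) g := by
    intro S f g
    simpa using tBil_suml τ X S (fun _ => 1) f g
  have sumr1 : ∀ (S : Finset E) (f : E → E → ℝ) (g : E → ℝ),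
    ∑ i ∈ S, tBil τ X g (f i) = tBil τ X g (fun u => ∑ i ∈ S, f i u) := by
    intro S f g
    simpa using tBil_sumr τ X S (fun _ => 1) f g
  calc _ ≤ ∑ s ∈ X, ∑ t ∈ X, ∑ s' ∈ X, ∑ t' ∈ X,
      ∑ π : Sys τ X, ∑ π' : Sys τ X, w π * (w π' * tBil τ X (fun u => if u ∈ π.1 s t then 1 else 0)
        (fun u => if u ∈ π'.1 s' t' then 1 else 0)) := by
        refine Finset.sum_le_sum fun s hs => Finset.sum_le_sum fun t ht =>
          Finset.sum_le_sum fun s' hs' => Finset.sum_le_sum fun t' ht' =>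
          Finset.sum_le_sum fun π _ => Finset.sum_le_sum fun π' _ => ?_
        rw [mul_assoc]
        refine mul_le_mul_of_nonneg_left (mul_le_mul_of_nonneg_left ?_ (hw0 _)) (hw0 _)
        exact tInd_le τ X _ _ (π.2 s hs t ht).1 (π'.2 s' hs' t' ht').1
    _ = tBil τ X (fun u => ∑ s ∈ X, ∑ t ∈ X, ∑ π : Sys τ X, w π * if u ∈ π.1 s t then 1 else 0)
        (fun u => ∑ s ∈ X, ∑ t ∈ X, ∑ π : Sys τ X, w π * if u ∈ π.1 s t then 1 else 0) := by
        simp_rw [← Finset.mul_sum, tBil_sumr, tBil_suml, sumr1, suml1]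
    _ = _ := by
        have : ∀ u, ∑ s ∈ X, ∑ t ∈ X, ∑ π : Sys τ X, (w π * if u ∈ π.1 s t then 1 else 0) =
            fcong τ X w u := by
          intro u
          unfold fcong cong
          simp_rw [Finset.mul_sum]
          conv_rhs => rw [Finset.sum_comm]
          refine Finset.sum_congr rfl fun s _ => ?_
          rw [Finset.sum_comm]
        simp_rw [this]

open Classical in
/-- touching degree -/
noncomputable def tdeg (X : Finset E) (u : E) : ℝ := ∑ y ∈ X, if τ u y then (1:ℝ) else 0

lemma tdeg_nonneg (X : Finset E) (u : E) : 0 ≤ tdeg τ X u := by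
  unfold tdeg; positivity

lemma tBil_le (hs : ∀ x y, τ x y → τ y x) (X : Finset E) (f : E → ℝ) :
    tBil τ X f f ≤ ∑ u ∈ X, tdeg τ X u * f u ^ 2 := by
  classical
  have hs' : ∀ x y, τ x y ↔ τ y x := fun x y => ⟨hs x y, hs y x⟩
  have h1 : ∑ u ∈ X, ∑ y ∈ X, (if τ u y then (1:ℝ) else 0) * f y ^ 2 =
      ∑ u ∈ X, tdeg τ X u * f u ^ 2 := by
    rw [Finset.sum_comm]
    refine Finset.sum_congr rfl fun u _ => ?_
    rw [← Finset.sum_mul]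
    congr 1
    unfold tdeg
    refine Finset.sum_congr rfl fun y _ => ?_
    simp [hs' u y]
  have h2 : ∑ u ∈ X, ∑ y ∈ X, (if τ u y then (1:ℝ) else 0) * f u ^ 2 =
      ∑ u ∈ X, tdeg τ X u * f u ^ 2 := by
    refine Finset.sum_congr rfl fun u _ => ?_
    rw [← Finset.sum_mul]
    congr 1
  have : 2 * tBil τ X f f ≤ 2 * ∑ u ∈ X, tdeg τ X u * f u ^ 2 := by
    have h3 : 2 * ∑ u ∈ X, tdeg τ X u * f u ^ 2 =
      ∑ u ∈ X, ∑ y ∈ X, (if τ u y then (1:ℝ) else 0) * f u ^ 2 +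
      ∑ u ∈ X, ∑ y ∈ X, (if τ u y then (1:ℝ) else 0) * f y ^ 2 := by rw [h1, h2]; ring
    rw [h3, ← Finset.sum_add_distrib]
    unfold tBil
    rw [Finset.mul_sum]
    refine Finset.sum_le_sum fun u _ => ?_
    rw [← Finset.sum_add_distrib, Finset.mul_sum]
    refine Finset.sum_le_sum fun y _ => ?_
    split_ifs
    · nlinarith [sq_nonneg (f u - f y)]
    · simp
  linarith

lemma flow_real (hs : ∀ x y, τ x y → τ y x) (hK : K5Prop τ) (X : Finset E)
    (hX : X.Nonempty) (hc : TConn τ X) (κ : ℝ) (hκ : 0 ≤ κ)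
    (hA : 120 * ∑ u ∈ X, tdeg τ X u ≤ κ ^ 2) :
    ∃ (l : E → ℝ) (A : ℝ), (∀ u, 0 ≤ l u) ∧ 0 < A ∧ ∑ u ∈ X, l u ≤ κ * A ∧
      ∀ π, ValidSys τ X π → A * (#X : ℝ) ^ 2 ≤ ∑ s ∈ X, ∑ t ∈ X, ∑ u ∈ π s t, l u := by
  classical
  have hne : Nonempty (Sys τ X) := ⟨⟨fun _ _ => X, fun s hs t ht => ⟨subset_rfl, hc, hs, ht⟩⟩⟩
  have hn : (0:ℝ) < #X := by exact_mod_cast hX.card_pos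
  set En : (Sys τ X → ℝ) → ℝ := fun w => ∑ u ∈ X, tdeg τ X u * fcong τ X w u ^ 2 with hEn
  have hcont : Continuous En := by
    simp only [hEn, fcong]
    fun_prop
  obtain ⟨w, hw, hmin⟩ := (isCompact_stdSimplex ℝ (Sys τ X)).exists_isMinOn
    ⟨_, single_mem_stdSimplex ℝ hne.some⟩ hcont.continuousOn
  have hlow : (#X : ℝ) ^ 4 ≤ 120 * En w :=
    (quad_bound τ hK X hX w hw.1 hw.2).trans (by
      have := (quad_le τ X w hw.1).trans (tBil_le τ hs X _)
      linarith)
  have hpos : 0 < En w := by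
    have : (0:ℝ) < (#X : ℝ)^4 := by positivity
    linarith
  have hf0 : ∀ u, 0 ≤ fcong τ X w u := fun u =>
    Finset.sum_nonneg fun π _ => mul_nonneg (hw.1 π) (by unfold cong; positivity)
  refine ⟨fun u => tdeg τ X u * fcong τ X w u, En w / (#X : ℝ)^2,
    fun u => mul_nonneg (tdeg_nonneg τ X u) (hf0 u), by positivity, ?_, ?_⟩
  · set Sl := ∑ u ∈ X, tdeg τ X u * fcong τ X w u with hSl
    have hSl0 : 0 ≤ Sl := Finset.sum_nonneg fun u _ => mul_nonneg (tdeg_nonneg τ X u) (hf0 u)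
    have cs : Sl ^ 2 ≤ (∑ u ∈ X, tdeg τ X u) * En w := by
      have := Finset.sum_sq_le_sum_mul_sum_of_sq_le_mul X
        (f := fun u => tdeg τ X u) (g := fun u => tdeg τ X u * fcong τ X w u ^ 2)
        (r := fun u => tdeg τ X u * fcong τ X w u)
        (fun u _ => tdeg_nonneg τ X u)
        (fun u _ => mul_nonneg (tdeg_nonneg τ X u) (sq_nonneg _))
        (fun u _ => le_of_eq (by ring))
      exact this
    rw [← mul_div_assoc, le_div_iff₀ (by positivity)]
    apply le_of_sq_le_sq _ (by positivity)
    have hT : 0 ≤ ∑ u ∈ X, tdeg τ X u := Finset.sum_nonneg fun u _ => tdeg_nonneg τ X u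
    calc (Sl * (#X:ℝ)^2)^2 = Sl^2 * (#X:ℝ)^4 := by ring
      _ ≤ ((∑ u ∈ X, tdeg τ X u) * En w) * (120 * En w) := by gcongr
      _ = (120 * ∑ u ∈ X, tdeg τ X u) * (En w)^2 := by ring
      _ ≤ κ^2 * (En w)^2 := by gcongr
      _ = _ := by ring
  · intro π hπ
    rw [div_mul_cancel₀ _ (by positivity)]
    set cp := cong X π with hcp
    have hfc : ∑ s ∈ X, ∑ t ∈ X, ∑ u ∈ π s t, tdeg τ X u * fcong τ X w u =
        ∑ u ∈ X, tdeg τ X u * fcong τ X w u * cp u := by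
      simp only [hcp, cong, Finset.mul_sum]
      conv_rhs => rw [Finset.sum_comm]
      refine Finset.sum_congr rfl fun s hs => ?_
      conv_rhs => rw [Finset.sum_comm]
      refine Finset.sum_congr rfl fun t ht => ?_
      simp only [mul_ite, mul_one, mul_zero, Finset.sum_ite_mem]
      rw [Finset.inter_eq_right.2 (hπ s hs t ht).1]
    rw [hfc]
    set M1 := ∑ u ∈ X, tdeg τ X u * fcong τ X w u * cp u with hM1
    set M2 := ∑ u ∈ X, tdeg τ X u * (cp u - fcong τ X w u)^2 with hM2
    have hM20 : 0 ≤ M2 := Finset.sum_nonneg fun u _ => mul_nonneg (tdeg_nonneg τ X u) (sq_nonneg _)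
    have var : ∀ ε : ℝ, 0 < ε → ε ≤ 1 → 0 ≤ 2 * ε * (M1 - En w) + ε^2 * M2 := by
      intro ε h0 h1
      set w' : Sys τ X → ℝ := (1 - ε) • w + ε • Pi.single ⟨π, hπ⟩ 1 with hw'
      have hmem : w' ∈ stdSimplex ℝ (Sys τ X) :=
        convex_stdSimplex ℝ _ hw (single_mem_stdSimplex ℝ _) (by linarith) h0.le (by ring)
      have := hmin hmem
      simp only [Set.mem_ofPred_eq] at this
      have hfw : ∀ u, fcong τ X w' u = fcong τ X w u + ε * (cp u - fcong τ X w u) := by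
        intro u
        simp only [fcong, hw', Pi.add_apply, Pi.smul_apply, smul_eq_mul, add_mul,
          Finset.sum_add_distrib, mul_assoc, ← Finset.mul_sum, Pi.single_apply, ite_mul, one_mul,
          zero_mul, Finset.sum_ite_eq', Finset.mem_univ, if_true]
        ring
      have hexp : En w' = En w + (2 * ε * (M1 - En w) + ε^2 * M2) := by
        simp only [hEn, hM1, hM2, hfw, Finset.mul_sum, ← Finset.sum_sub_distrib,
          ← Finset.sum_add_distrib]
        refine Finset.sum_congr rfl fun u _ => ?_
        ring
      linarith
    by_contra! hlt
    have hd : 0 < En w - M1 := by linarith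
    have h0 : 0 < min 1 ((En w - M1) / (M2 + 1)) := lt_min one_pos (by positivity)
    have := var _ h0 (min_le_left _ _)
    set ε := min 1 ((En w - M1) / (M2 + 1)) with hε
    have h2 : ε * (M2 + 1) ≤ En w - M1 := by
      rw [← le_div_iff₀ (by positivity)]; exact min_le_right _ _
    nlinarith

/-- integral version -/
lemma flow_nat (hs : ∀ x y, τ x y → τ y x) (hK : K5Prop τ) (X : Finset E)
    (hX : X.Nonempty) (hc : TConn τ X) (κ : ℝ) (hκ : 1 ≤ κ)
    (hA : 120 * ∑ u ∈ X, tdeg τ X u ≤ (κ - 1) ^ 2) (A : ℝ) (hAn : (#X : ℝ) ≤ A) :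
    ∃ (l : E → ℕ), (∑ u ∈ X, l u : ℕ) ≤ κ * A ∧
      ∀ π, ValidSys τ X π → A * (#X : ℝ) ^ 2 ≤ (∑ s ∈ X, ∑ t ∈ X, ∑ u ∈ π s t, l u : ℕ) := by
  obtain ⟨l, B, hl0, hB, hl1, hl2⟩ := flow_real τ hs hK X hX hc (κ - 1) (by linarith) hA
  have hn : (0:ℝ) < #X := by exact_mod_cast hX.card_pos
  have hA0 : 0 < A := by linarith
  refine ⟨fun u => ⌈A / B * l u⌉₊, ?_, ?_⟩
  · push_cast
    calc (∑ u ∈ X, (⌈A / B * l u⌉₊ : ℝ)) ≤ ∑ u ∈ X, (A / B * l u + 1) :=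
          Finset.sum_le_sum fun u _ => (Nat.ceil_lt_add_one (mul_nonneg (by positivity) (hl0 u))).le
      _ = A / B * ∑ u ∈ X, l u + #X := by
          rw [Finset.sum_add_distrib, Finset.mul_sum]; simp
      _ ≤ A / B * ((κ - 1) * B) + A := by gcongr
      _ = κ * A := by field_simp; ring
  · intro π hπ
    push_cast
    calc A * (#X:ℝ)^2 = A / B * (B * (#X:ℝ)^2) := by field_simp
      _ ≤ A / B * ∑ s ∈ X, ∑ t ∈ X, ∑ u ∈ π s t, l u := by
          have := hl2 π hπ; gcongr
      _ = ∑ s ∈ X, ∑ t ∈ X, ∑ u ∈ π s t, A / B * l u := by simp_rw [Finset.mul_sum]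
      _ ≤ _ := by
          refine Finset.sum_le_sum fun s _ => Finset.sum_le_sum fun t _ =>
            Finset.sum_le_sum fun u _ => Nat.le_ceil _
end flow


/-- elimination cost -/
inductive Elim {E : Type*} [DecidableEq E] (τ : E → E → Prop) : Finset E → ℕ → Prop
  | empty : Elim τ ∅ 0
  | add (X : Finset E) (s : E) (c : ℕ) (hs : s ∉ X) (h : Elim τ X c) :
      Elim τ (insert s X) (c + #X)
  | union (A B : Finset E) (c d : ℕ) (hd : Disjoint A B) (hn : ∀ a ∈ A, ∀ b ∈ B, ¬ τ a b)
      (hA : Elim τ A c) (hB : Elim τ B d) : Elim τ (A ∪ B) (c + d)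

section region
variable {E : Type*} [DecidableEq E] {τ : E → E → Prop}

lemma elim_addset {X : Finset E} {c : ℕ} (h : Elim τ X c) (S : Finset E) (hd : Disjoint X S) :
    ∃ c', Elim τ (X ∪ S) c' ∧ c' + #S ≤ c + #S * (#X + #S) := by
  induction S using Finset.induction_on with
  | empty => exact ⟨c, by simpa using h, by simp⟩
  | insert s S hs ih =>
    rw [Finset.disjoint_insert_right] at hd
    obtain ⟨c', h1, h2⟩ := ih hd.2
    refine ⟨c' + #(X ∪ S), ?_, ?_⟩
    · rw [Finset.union_insert]
      exact Elim.add _ _ _ (by simp [hs, hd.1]) h1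
    · rw [Finset.card_union_of_disjoint hd.2, Finset.card_insert_of_notMem hs]
      nlinarith

variable (τ) in
open Classical in
noncomputable def Bs (l : E → ℕ) (Y : Finset E) (v : E) (r : ℕ) : Finset E :=
  Y.filter fun u => ∃ U ⊆ Y, TConn τ U ∧ v ∈ U ∧ u ∈ U ∧ ∑ x ∈ U, l x < r

variable (τ) in
open Classical in
noncomputable def Cs (l : E → ℕ) (Y : Finset E) (v : E) (r : ℕ) : Finset E :=
  Y.filter fun u => ∃ U ⊆ Y, TConn τ U ∧ v ∈ U ∧ u ∈ U ∧ ∑ x ∈ U.erase u, l x < r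

lemma Bs_sub_Cs (l : E → ℕ) (Y : Finset E) (v : E) (r : ℕ) : Bs τ l Y v r ⊆ Cs τ l Y v r := by
  intro u hu
  simp only [Bs, Cs, mem_filter] at *
  obtain ⟨hu, U, h1, h2, h3, h4, h5⟩ := hu
  refine ⟨hu, U, h1, h2, h3, h4, lt_of_le_of_lt ?_ h5⟩
  exact Finset.sum_le_sum_of_subset (erase_subset _ _)

lemma Cs_sub (l : E → ℕ) (Y : Finset E) (v : E) (r : ℕ) : Cs τ l Y v r ⊆ Y := by
  classical
  exact filter_subset _ _

lemma Bs_mono (l : E → ℕ) {Y X : Finset E} (hY : Y ⊆ X) (v : E) {r R : ℕ} (hr : r ≤ R) :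
    Bs τ l Y v r ⊆ Bs τ l X v R := by
  intro u hu
  simp only [Bs, mem_filter] at *
  obtain ⟨hu, U, h1, h2, h3, h4, h5⟩ := hu
  exact ⟨hY hu, U, h1.trans hY, h2, h3, h4, by omega⟩

lemma Cs_mono (l : E → ℕ) (Y : Finset E) (v : E) {r R : ℕ} (hr : r ≤ R) :
    Cs τ l Y v r ⊆ Cs τ l Y v R := by
  intro u hu
  simp only [Cs, mem_filter] at *
  obtain ⟨hu, U, h1, h2, h3, h4, h5⟩ := hu
  exact ⟨hu, U, h1, h2, h3, h4, by omega⟩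

lemma TConn_singleton (v : E) : TConn τ {v} := by
  intro a ha b hb
  rw [mem_singleton] at ha hb
  rw [ha, hb]

lemma TConn_union (hs : ∀ x y, τ x y → τ y x) {U W : Finset E} (hU : TConn τ U) (hW : TConn τ W)
    {a b : E} (ha : a ∈ U) (hb : b ∈ W) (hab : a = b ∨ τ a b) : TConn τ (U ∪ W) := by
  have h1 : ∀ x ∈ U, ∀ y ∈ U,
      Relation.ReflTransGen (fun x y => x ∈ U ∪ W ∧ y ∈ U ∪ W ∧ τ x y) x y := fun x hx y hy =>
    Relation.ReflTransGen.mono (fun p q h => ⟨mem_union_left _ h.1, mem_union_left _ h.2.1, h.2.2⟩) _ _ (hU x hx y hy)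
  have h2 : ∀ x ∈ W, ∀ y ∈ W,
      Relation.ReflTransGen (fun x y => x ∈ U ∪ W ∧ y ∈ U ∪ W ∧ τ x y) x y := fun x hx y hy =>
    Relation.ReflTransGen.mono (fun p q h => ⟨mem_union_right _ h.1, mem_union_right _ h.2.1, h.2.2⟩) _ _ (hW x hx y hy)
  have h3 : Relation.ReflTransGen (fun x y => x ∈ U ∪ W ∧ y ∈ U ∪ W ∧ τ x y) a b := by
    rcases hab with rfl | h
    · exact .refl
    · exact .single ⟨mem_union_left _ ha, mem_union_right _ hb, h⟩
  have h4 : Relation.ReflTransGen (fun x y => x ∈ U ∪ W ∧ y ∈ U ∪ W ∧ τ x y) b a := by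
    rcases hab with rfl | h
    · exact .refl
    · exact .single ⟨mem_union_right _ hb, mem_union_left _ ha, hs _ _ h⟩
  intro x hx y hy
  rcases mem_union.1 hx with hx | hx <;> rcases mem_union.1 hy with hy | hy
  · exact h1 x hx y hy
  · exact ((h1 x hx a ha).trans h3).trans (h2 b hb y hy)
  · exact ((h2 x hx b hb).trans h4).trans (h1 a ha y hy)
  · exact h2 x hx y hy

lemma Cs_self (l : E → ℕ) {Y : Finset E} {v : E} (hv : v ∈ Y) {r : ℕ} (hr : 1 ≤ r) :
    v ∈ Cs τ l Y v r := by
  simp only [Cs, mem_filter]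
  exact ⟨hv, {v}, by simpa using hv, TConn_singleton v, by simp, by simp, by simp; omega⟩

lemma Bs_nbr (hs : ∀ x y, τ x y → τ y x) (l : E → ℕ) (Y : Finset E) (v : E) (r : ℕ)
    {u w : E} (hu : u ∈ Bs τ l Y v r) (hw : w ∈ Y) (h : τ u w) : w ∈ Cs τ l Y v r := by
  simp only [Bs, Cs, mem_filter] at *
  obtain ⟨hu, U, h1, h2, h3, h4, h5⟩ := hu
  refine ⟨hw, U ∪ {w}, union_subset h1 (by simpa using hw),
    TConn_union hs h2 (TConn_singleton w) h4 (by simp) (Or.inr h), by simp [h3], by simp, ?_⟩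
  refine lt_of_le_of_lt (Finset.sum_le_sum_of_subset ?_) h5
  intro x hx
  simp at hx
  tauto

lemma S_count (l : E → ℕ) (Y : Finset E) (v u : E) (J : Finset ℕ) :
    #{r ∈ J | u ∈ Cs τ l Y v r \ Bs τ l Y v r} ≤ l u := by
  classical
  rcases Finset.eq_empty_or_nonempty {r ∈ J | u ∈ Cs τ l Y v r \ Bs τ l Y v r} with h | ⟨r0, h0⟩
  · rw [h]; simp
  · simp only [mem_filter, mem_sdiff, Cs] at h0
    obtain ⟨-, ⟨huY, U0, h1, h2, h3, h4, h5⟩, -⟩ := h0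
    obtain ⟨U, hU, hmin⟩ := Finset.exists_min_image
      (Y.powerset.filter fun U => TConn τ U ∧ v ∈ U ∧ u ∈ U) (fun U => ∑ x ∈ U.erase u, l x)
      ⟨U0, by simp [h1, h2, h3, h4]⟩
    simp only [mem_filter, mem_powerset] at hU hmin
    set d := ∑ x ∈ U.erase u, l x with hd
    have hsum : ∑ x ∈ U, l x = d + l u := (Finset.sum_erase_add _ _ hU.2.2.2).symm
    have : {r ∈ J | u ∈ Cs τ l Y v r \ Bs τ l Y v r} ⊆ Finset.Ioc d (d + l u) := by
      intro r hr
      simp only [mem_filter, mem_sdiff, Cs, Bs] at hr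
      obtain ⟨-, ⟨-, W, g1, g2, g3, g4, g5⟩, hr2⟩ := hr
      have := hmin W ⟨g1, g2, g3, g4⟩
      rw [mem_Ioc]
      refine ⟨by omega, ?_⟩
      by_contra! hc
      exact hr2 ⟨huY, U, hU.1, hU.2.1, hU.2.2.1, hU.2.2.2, by omega⟩
    simpa using Finset.card_le_card this

lemma S_sum (l : E → ℕ) (Y : Finset E) (v : E) (J : Finset ℕ) (Z : Finset E)
    (hZ : ∀ r ∈ J, Cs τ l Y v r ⊆ Z) :
    ∑ r ∈ J, #(Cs τ l Y v r \ Bs τ l Y v r) ≤ ∑ u ∈ Z, l u := by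
  classical
  have h1 : ∀ r ∈ J, #(Cs τ l Y v r \ Bs τ l Y v r) =
      ∑ u ∈ Z, if u ∈ Cs τ l Y v r \ Bs τ l Y v r then 1 else 0 := by
    intro r hr
    rw [Finset.sum_ite_mem, Finset.card_eq_sum_ones]
    congr 1
    exact (Finset.inter_eq_right.2 (sdiff_subset.trans (hZ r hr))).symm
  rw [Finset.sum_congr rfl h1, Finset.sum_comm]
  refine Finset.sum_le_sum fun u _ => ?_
  have := S_count (τ := τ) l Y v u J
  rwa [Finset.card_filter] at this

lemma elim_split (hs : ∀ x y, τ x y → τ y x) (l : E → ℕ) (Y : Finset E) (v : E) (r : ℕ)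
    {c d : ℕ} (h1 : Elim τ (Bs τ l Y v r) c) (h2 : Elim τ (Y \ Cs τ l Y v r) d) :
    ∃ c', Elim τ Y c' ∧ c' ≤ c + d + #(Cs τ l Y v r \ Bs τ l Y v r) * #Y := by
  have hBC := Bs_sub_Cs (τ := τ) l Y v r
  have hC := Cs_sub (τ := τ) l Y v r
  have hd : Disjoint (Bs τ l Y v r) (Y \ Cs τ l Y v r) :=
    Finset.disjoint_of_subset_left hBC disjoint_sdiff
  have h3 := Elim.union _ _ _ _ hd (fun a ha b hb hab => by
    rw [mem_sdiff] at hb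
    exact hb.2 (Bs_nbr hs l Y v r ha hb.1 hab)) h1 h2
  obtain ⟨c', h4, h5⟩ := elim_addset h3 (Cs τ l Y v r \ Bs τ l Y v r) (by
    rw [Finset.disjoint_union_left]
    exact ⟨disjoint_sdiff, Finset.disjoint_of_subset_right sdiff_subset sdiff_disjoint⟩)
  have hY : Bs τ l Y v r ∪ Y \ Cs τ l Y v r ∪ Cs τ l Y v r \ Bs τ l Y v r = Y := by
    ext x
    have a1 := @hBC x
    have a2 := @hC x
    simp only [mem_union, mem_sdiff]
    tauto
  have hcard : #(Bs τ l Y v r ∪ Y \ Cs τ l Y v r) + #(Cs τ l Y v r \ Bs τ l Y v r) = #Y := by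
    rw [← Finset.card_union_of_disjoint, hY]
    rw [Finset.disjoint_union_left]
    exact ⟨disjoint_sdiff, Finset.disjoint_of_subset_right sdiff_subset sdiff_disjoint⟩
  rw [hY] at h4
  rw [hcard] at h5
  exact ⟨c', h4, by omega⟩

lemma growth (s : ℕ → ℝ) (q R : ℕ) (T : ℝ) (hq : 0 < q)
    (h : ∀ r < R, T + ∑ i ∈ range r, s (i + 1) ≤ s (r + 1) * q) :
    T * (1 + 1 / (q:ℝ)) ^ R ≤ T + ∑ i ∈ range R, s (i + 1) := by
  induction R with
  | zero => simp
  | succ R ih =>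
    have i1 := ih fun r hr => h r (by omega)
    have i2 := h R (by omega)
    have hq' : (0:ℝ) < q := by exact_mod_cast hq
    rw [Finset.sum_range_succ, pow_succ, ← mul_assoc]
    set F := T + ∑ i ∈ range R, s (i + 1)
    have : F / q ≤ s (R+1) := by rwa [div_le_iff₀ hq']
    calc T * (1 + 1 / (q:ℝ)) ^ R * (1 + 1 / (q:ℝ)) ≤ F * (1 + 1 / (q:ℝ)) := by gcongr
      _ = F + F / q := by ring
      _ ≤ F + s (R+1) := by linarith
      _ = _ := by simp only [F]; ring

lemma region (l : E → ℕ) (X : Finset E) (hL : 0 < ∑ u ∈ X, l u) (k q : ℕ) (hk : #X ≤ 2 ^ k)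
    (hq : 0 < q) (Y : Finset E) (hY : Y ⊆ X) (v : E) (hv : v ∈ Y) :
    ∃ r, 1 ≤ r ∧ r ≤ q * (k + 2) ∧ (#(Cs τ l Y v r \ Bs τ l Y v r) : ℝ) * q ≤
      (∑ u ∈ X, l u : ℕ) / (#X : ℝ) + (∑ u ∈ Cs τ l Y v r, l u : ℕ) := by
  by_contra! hcon
  set L : ℕ := ∑ u ∈ X, l u with hLdef
  have hXc : 0 < #X := Finset.card_pos.2 ⟨v, hY hv⟩
  have hn : (0:ℝ) < #X := by exact_mod_cast hXc
  have hL' : (0:ℝ) < L := by exact_mod_cast hL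
  have hq' : (0:ℝ) < q := by exact_mod_cast hq
  set s : ℕ → ℝ := fun r => (#(Cs τ l Y v r \ Bs τ l Y v r) : ℝ) with hsd
  have hS : ∀ r, ∀ Z, Cs τ l Y v r ⊆ Z →
      ∑ i ∈ range r, s (i + 1) ≤ (∑ u ∈ Z, l u : ℕ) := by
    intro r Z hZ
    have := S_sum (τ := τ) l Y v ((range r).image (· + 1)) Z (by
      intro i hi
      simp only [mem_image, mem_range] at hi
      obtain ⟨a, ha, rfl⟩ := hi
      exact (Cs_mono l Y v (by omega)).trans hZ)
    rw [Finset.sum_image (by intro a _ b _ h; simpa using h)] at this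
    simp only [hsd]
    exact_mod_cast this
  have g := growth s q (q * (k+2)) (L / #X) hq (by
    intro r hr
    have h1 := hcon (r + 1) (by omega) (by omega)
    have h2 := hS r (Cs τ l Y v (r+1)) (Cs_mono l Y v (by omega))
    simp only [hsd] at h2 ⊢
    linarith)
  have h1 := hS (q * (k+2)) X ((Cs_sub l Y v _).trans hY)
  have h2 : (2:ℝ) ^ (k+2) ≤ (1 + 1 / (q:ℝ)) ^ (q * (k+2)) := by
    rw [pow_mul]
    gcongr
    have := one_add_mul_le_pow (a := 1 / (q:ℝ)) (by
      have : (0:ℝ) ≤ 1 / q := by positivity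
      linarith) q
    rw [mul_one_div_cancel hq'.ne'] at this
    linarith
  have h3 : (#X : ℝ) ≤ 2 ^ k := by exact_mod_cast hk
  have h4 : 4 * (L:ℝ) ≤ L / #X * (1 + 1 / (q:ℝ)) ^ (q * (k+2)) := by
    calc 4 * (L:ℝ) = L / #X * (4 * #X) := by field_simp
      _ ≤ L / #X * (2:ℝ)^(k+2) := by
          gcongr; rw [pow_add]; linarith
      _ ≤ _ := by gcongr
  have h5 : (L:ℝ) / #X ≤ L := div_le_self hL'.le (by exact_mod_cast hXc)
  have h6 : ((∑ u ∈ X, l u : ℕ) : ℝ) = L := rfl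
  rw [h6] at h1
  linarith

/-- small balls everywhere: repeated region growing -/
lemma case_small (hs : ∀ x y, τ x y → τ y x) (l : E → ℕ) (X : Finset E)
    (hL : 0 < ∑ u ∈ X, l u) (k q : ℕ) (hk : #X ≤ 2 ^ k) (hq : 0 < q) (Kb : ℝ)
    (hB : ∀ v ∈ X, ∀ B ⊆ Bs τ l X v (q * (k+2)), ∃ c : ℕ, Elim τ B c ∧ (c:ℝ) ≤ Kb * #B)
    (hKb : 0 ≤ Kb) (m : ℕ) :
    ∀ Y ⊆ X, #Y ≤ m → ∃ c : ℕ, Elim τ Y c ∧ (c:ℝ) ≤ Kb * #Y +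
      #X / q * ((∑ u ∈ Y, l u : ℕ) + #Y * ((∑ u ∈ X, l u : ℕ) / (#X : ℝ))) := by
  induction m with
  | zero =>
    intro Y _ hY
    have : Y = ∅ := by simpa using hY
    subst this
    exact ⟨0, Elim.empty, by simp⟩
  | succ m ih =>
    intro Y hYX hY
    rcases Finset.eq_empty_or_nonempty Y with rfl | ⟨v, hv⟩
    · exact ⟨0, Elim.empty, by simp⟩
    obtain ⟨r, h1, h2, h3⟩ := region (τ := τ) l X hL k q hk hq Y hYX v hv
    obtain ⟨c, hc, hc'⟩ := hB v (hYX hv) _ (Bs_mono l hYX v h2)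
    set L : ℕ := ∑ u ∈ X, l u with hLdef
    set C := Cs τ l Y v r with hC
    have hvC : v ∈ C := Cs_self l hv h1
    have hCY : C ⊆ Y := Cs_sub l Y v r
    have hBC : Bs τ l Y v r ⊆ C := Bs_sub_Cs l Y v r
    have hcard : #(Y \ C) + #C = #Y := Finset.card_sdiff_add_card_eq_card hCY
    have hCp : 0 < #C := Finset.card_pos.2 ⟨v, hvC⟩
    obtain ⟨d, hd, hd'⟩ := ih (Y \ C) (sdiff_subset.trans hYX) (by omega)
    obtain ⟨e, he, he'⟩ := elim_split hs l Y v r hc hd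
    refine ⟨e, he, ?_⟩
    have hsum : ∑ u ∈ Y \ C, l u + ∑ u ∈ C, l u = ∑ u ∈ Y, l u := Finset.sum_sdiff hCY
    have e1 : (e:ℝ) ≤ c + d + #(C \ Bs τ l Y v r) * #Y := by exact_mod_cast he'
    have hYn : (#Y:ℝ) ≤ #X := by exact_mod_cast Finset.card_le_card hYX
    have hBn : (#(Bs τ l Y v r):ℝ) ≤ #C := by exact_mod_cast Finset.card_le_card hBC
    have hq' : (0:ℝ) < q := by exact_mod_cast hq
    have e2 : (#(C \ Bs τ l Y v r) : ℝ) * #Y ≤ #X / q * (L / (#X:ℝ) + (∑ u ∈ C, l u : ℕ)) := by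
      rw [div_mul_eq_mul_div, le_div_iff₀ hq']
      calc (#(C \ Bs τ l Y v r) : ℝ) * #Y * q = #Y * (#(C \ Bs τ l Y v r) * q) := by ring
        _ ≤ #X * (L / (#X:ℝ) + (∑ u ∈ C, l u : ℕ)) := by gcongr
    have e3 : (#X:ℝ) / q * (L / (#X:ℝ) + (∑ u ∈ C, l u : ℕ)) ≤
        #X / q * (#C * (L / (#X:ℝ)) + (∑ u ∈ C, l u : ℕ)) := by
      gcongr
      apply le_mul_of_one_le_left (by positivity)
      exact_mod_cast hCp
    have e4 : Kb * #(Bs τ l Y v r) ≤ Kb * #C := by gcongr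
    rw [← hcard, ← hsum]
    push_cast at *
    linarith
end region


section region
variable {E : Type*} [DecidableEq E] {τ : E → E → Prop}

lemma case_big (hs : ∀ x y, τ x y → τ y x) (l : E → ℕ) (X : Finset E) (hc : TConn τ X)
    (κ : ℝ) (hκ : 1 ≤ κ) (R : ℕ) (hR : 1 ≤ R)
    (hL : (∑ u ∈ X, l u : ℕ) ≤ κ * (8 * R))
    (hn : 8 * κ ≤ #X)
    (hfl : ∀ π, ValidSys τ X π → 8 * R * (#X : ℝ) ^ 2 ≤ (∑ s ∈ X, ∑ t ∈ X, ∑ u ∈ π s t, l u : ℕ))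
    (v : E) (hv : v ∈ X) :
    ∃ r, R ≤ r ∧ (X \ Cs τ l X v r).Nonempty ∧
      (#(Cs τ l X v r \ Bs τ l X v r) : ℝ) * #X ≤ 4 * κ * #(X \ Cs τ l X v r) := by
  classical
  by_contra! hcon
  set L : ℕ := ∑ u ∈ X, l u with hLdef
  have hR' : (1:ℝ) ≤ R := by exact_mod_cast hR
  have hmin : ∀ u ∈ X, ∃ U ⊆ X, TConn τ U ∧ v ∈ U ∧ u ∈ U ∧
      ∀ W ⊆ X, TConn τ W → v ∈ W → u ∈ W → ∑ x ∈ U.erase u, l x ≤ ∑ x ∈ W.erase u, l x := by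
    intro u hu
    obtain ⟨U, hU, hm⟩ := Finset.exists_min_image
      (X.powerset.filter fun U => TConn τ U ∧ v ∈ U ∧ u ∈ U) (fun U => ∑ x ∈ U.erase u, l x)
      ⟨X, by simp [hc, hu, hv]⟩
    simp only [mem_filter, mem_powerset] at hU hm
    exact ⟨U, hU.1, hU.2.1, hU.2.2.1, hU.2.2.2, fun W h1 h2 h3 h4 => hm W ⟨h1, h2, h3, h4⟩⟩
  choose! U hUX hUc hvU huU hUm using hmin
  set dp : E → ℕ := fun u => ∑ x ∈ (U u).erase u, l x with hdp
  have hlU : ∀ u ∈ X, ∑ x ∈ U u, l x = dp u + l u := fun u hu =>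
    (Finset.sum_erase_add _ _ (huU u hu)).symm
  have hdpL : ∀ u ∈ X, dp u ≤ L := fun u hu =>
    Finset.sum_le_sum_of_subset ((erase_subset _ _).trans (hUX u hu))
  have hO : ∀ u ∈ X, ∀ r ≤ dp u, u ∈ X \ Cs τ l X v r := by
    intro u hu r hr
    simp only [mem_sdiff, Cs, mem_filter]
    refine ⟨hu, ?_⟩
    rintro ⟨-, W, h1, h2, h3, h4, h5⟩
    have := hUm u hu W h1 h2 h3 h4
    simp only [hdp] at hr
    omega
  have hsumO : ∑ u ∈ X, dp u ≤ ∑ r ∈ Icc 1 L, #(X \ Cs τ l X v r) := by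
    have h1 : ∀ r ∈ Icc 1 L, #(X \ Cs τ l X v r) =
        ∑ u ∈ X, if u ∈ X \ Cs τ l X v r then 1 else 0 := by
      intro r _
      rw [Finset.sum_ite_mem, Finset.inter_eq_right.2 sdiff_subset, Finset.card_eq_sum_ones]
    rw [Finset.sum_congr rfl h1, Finset.sum_comm]
    refine Finset.sum_le_sum fun u hu => ?_
    rw [← Finset.card_filter]
    have : Icc 1 (dp u) ⊆ {r ∈ Icc 1 L | u ∈ X \ Cs τ l X v r} := by
      intro r hr
      rw [mem_Icc] at hr
      rw [mem_filter, mem_Icc]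
      exact ⟨⟨hr.1, hr.2.trans (hdpL u hu)⟩, hO u hu r hr.2⟩
    simpa using Finset.card_le_card this
  have hflow := hfl (fun s t => U s ∪ U t) (fun s hs' t ht =>
    ⟨union_subset (hUX s hs') (hUX t ht),
      TConn_union hs (hUc s hs') (hUc t ht) (hvU s hs') (hvU t ht) (Or.inl rfl),
      mem_union_left _ (huU s hs'), mem_union_right _ (huU t ht)⟩)
  have hfl2 : ∑ s ∈ X, ∑ t ∈ X, ∑ u ∈ U s ∪ U t, l u ≤ 2 * #X * (∑ u ∈ X, dp u + L) := by
    calc _ ≤ ∑ s ∈ X, ∑ t ∈ X, ((dp s + l s) + (dp t + l t)) := by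
          refine Finset.sum_le_sum fun s hs' => Finset.sum_le_sum fun t ht => ?_
          rw [← hlU s hs', ← hlU t ht]
          have := Finset.sum_union_inter (s₁ := U s) (s₂ := U t) (f := l)
          omega
      _ = _ := by
          simp only [Finset.sum_add_distrib, Finset.sum_const, smul_eq_mul, ← Finset.mul_sum]
          ring
  have hnp : (0:ℝ) < #X := by linarith
  have f1 : 8 * R * (#X : ℝ)^2 ≤ 2 * #X * ((∑ u ∈ X, dp u : ℕ) + L) :=
    hflow.trans (by exact_mod_cast hfl2)
  have f2 : 4 * R * (#X:ℝ) ≤ (∑ u ∈ X, dp u : ℕ) + L := by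
    have : 2 * (#X:ℝ) * (4 * R * (#X:ℝ)) ≤ 2 * #X * ((∑ u ∈ X, dp u : ℕ) + L) := by linarith
    exact le_of_mul_le_mul_left this (by positivity)
  have f3 : (L:ℝ) ≤ R * #X := by nlinarith
  have f4 : ∑ r ∈ Icc 1 L, #(X \ Cs τ l X v r) ≤
      R * #X + ∑ r ∈ Icc R L, #(X \ Cs τ l X v r) := by
    calc _ ≤ ∑ r ∈ range R ∪ Icc R L, #(X \ Cs τ l X v r) := by
          apply Finset.sum_le_sum_of_subset
          intro r hr
          simp only [mem_union, mem_range, mem_Icc] at *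
          omega
      _ ≤ ∑ r ∈ range R, #(X \ Cs τ l X v r) + ∑ r ∈ Icc R L, #(X \ Cs τ l X v r) := by
          have := Finset.sum_union_inter (s₁ := range R) (s₂ := Icc R L)
            (f := fun r => #(X \ Cs τ l X v r))
          omega
      _ ≤ _ := by
          gcongr
          have := Finset.sum_le_card_nsmul (range R) (fun r => #(X \ Cs τ l X v r)) #X
            (fun r _ => Finset.card_le_card sdiff_subset)
          simpa using this
  have f5 : 2 * R * (#X:ℝ) ≤ (∑ r ∈ Icc R L, #(X \ Cs τ l X v r) : ℕ) := by
    have g1 : ((∑ u ∈ X, dp u : ℕ) : ℝ) ≤ (∑ r ∈ Icc 1 L, #(X \ Cs τ l X v r) : ℕ) := by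
      exact_mod_cast hsumO
    have g2 : ((∑ r ∈ Icc 1 L, #(X \ Cs τ l X v r) : ℕ) : ℝ) ≤
      R * #X + (∑ r ∈ Icc R L, #(X \ Cs τ l X v r) : ℕ) := by exact_mod_cast f4
    linarith
  have f6 : ∑ r ∈ Icc R L, #(Cs τ l X v r \ Bs τ l X v r) ≤ L :=
    S_sum l X v (Icc R L) X (fun r _ => Cs_sub l X v r)
  have f6' : (∑ r ∈ Icc R L, (#(Cs τ l X v r \ Bs τ l X v r) : ℝ)) ≤ L := by exact_mod_cast f6
  push_cast at f5
  have hex : ∃ r ∈ Icc R L, (X \ Cs τ l X v r).Nonempty := by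
    by_contra! hno
    rw [Finset.sum_eq_zero] at f5
    · nlinarith
    · intro r hr; rw [hno r hr]; simp
  obtain ⟨r0, hr0, hr0'⟩ := hex
  have f7 : ∑ r ∈ Icc R L, 4 * κ * (#(X \ Cs τ l X v r):ℝ) <
      ∑ r ∈ Icc R L, (#(Cs τ l X v r \ Bs τ l X v r) : ℝ) * #X := by
    apply Finset.sum_lt_sum
    · intro r hr
      rcases Finset.eq_empty_or_nonempty (X \ Cs τ l X v r) with h | h
      · rw [h]; simp; positivity
      · exact (hcon r (mem_Icc.1 hr).1 h).le
    · exact ⟨r0, hr0, hcon r0 (mem_Icc.1 hr0).1 hr0'⟩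
  rw [← Finset.mul_sum, ← Finset.sum_mul] at f7
  have f8 : 4 * κ * (2 * R * (#X:ℝ)) ≤ 4 * κ * ∑ r ∈ Icc R L, (#(X \ Cs τ l X v r):ℝ) := by
    gcongr
  have f9 : (∑ r ∈ Icc R L, (#(Cs τ l X v r \ Bs τ l X v r) : ℝ)) * #X ≤ κ * (8 * R) * #X := by
    gcongr; linarith
  linarith

theorem elim_bound [Fintype E] (hs : ∀ x y, τ x y → τ y x) (hK : K5Prop τ)
    (X0 : Finset E) (κ : ℝ) (hκ : 1 ≤ κ)
    (hA : 120 * ∑ u ∈ X0, tdeg τ X0 u ≤ (κ - 1) ^ 2) (k : ℕ) (hk : #X0 ≤ 2 ^ k)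
    (K : ℝ) (hKK : 16 * κ * (k + 2) ≤ K * Real.log 2) (m : ℕ) :
    ∀ X ⊆ X0, #X ≤ m → ∃ c : ℕ, Elim τ X c ∧ (c:ℝ) ≤ K * #X * Real.log #X := by
  classical
  have hlog2 : 0 < Real.log 2 := Real.log_pos (by norm_num)
  have hK32 : 32 * κ ≤ K * Real.log 2 := by
    have : (0:ℝ) ≤ k := by positivity
    nlinarith
  have hKpos : 0 < K := by
    by_contra! h
    nlinarith
  induction m with
  | zero =>
    intro X _ hX
    have : X = ∅ := by simpa using hX
    subst this
    exact ⟨0, Elim.empty, by simp⟩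
  | succ m ih =>
    intro X hX0 hXm
    have hk' : #X ≤ 2 ^ k := (Finset.card_le_card hX0).trans hk
    by_cases hsmall : (#X : ℝ) ≤ 8 * κ
    · obtain ⟨c, h1, h2⟩ := elim_addset (τ := τ) Elim.empty X (by simp)
      simp only [Finset.empty_union, Finset.card_empty, zero_add] at h1 h2
      refine ⟨c, h1, ?_⟩
      rcases Nat.lt_or_ge #X 2 with h | h
      · have : c = 0 := by nlinarith
        subst this
        have : 0 ≤ Real.log #X := Real.log_natCast_nonneg _
        push_cast; positivity
      · have hl : Real.log 2 ≤ Real.log #X := Real.log_le_log (by norm_num) (by exact_mod_cast h)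
        have h2' : (c:ℝ) ≤ #X * #X := by
          have : c ≤ #X * #X := by omega
          exact_mod_cast this
        have hp : (0:ℝ) ≤ #X := by positivity
        calc (c:ℝ) ≤ #X * #X := h2'
          _ ≤ #X * (8 * κ) := by gcongr
          _ ≤ #X * (K * Real.log 2) := mul_le_mul_of_nonneg_left (by linarith) hp
          _ ≤ #X * (K * Real.log #X) := by gcongr
          _ = _ := by ring
    push Not at hsmall
    have hXp : (0:ℝ) < #X := by linarith
    have hXne : X.Nonempty := by
      rw [← Finset.card_pos]; exact_mod_cast hXp
    by_cases hc : TConn τ X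
    swap
    · unfold TConn at hc
      push Not at hc
      obtain ⟨a, ha, b, hb, hab⟩ := hc
      set P := X.filter fun x => Relation.ReflTransGen (fun x y => x ∈ X ∧ y ∈ X ∧ τ x y) a x with hP
      have haP : a ∈ P := by simp [hP, ha, Relation.ReflTransGen.refl]
      have hbP : b ∈ X \ P := by simp [hP, hb, hab]
      have hPX : P ⊆ X := filter_subset _ _
      have hcard : #(X \ P) + #P = #X := Finset.card_sdiff_add_card_eq_card hPX
      have hp1 : 0 < #P := Finset.card_pos.2 ⟨a, haP⟩
      have hp2 : 0 < #(X \ P) := Finset.card_pos.2 ⟨b, hbP⟩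
      obtain ⟨c, h1, h2⟩ := ih P (hPX.trans hX0) (by omega)
      obtain ⟨d, h3, h4⟩ := ih (X \ P) (sdiff_subset.trans hX0) (by omega)
      refine ⟨c + d, ?_, ?_⟩
      · have := Elim.union P (X \ P) c d disjoint_sdiff (by
          intro x hx y hy hxy
          simp only [hP, mem_filter, mem_sdiff, not_and] at hx hy
          exact hy.2 hy.1 (hx.2.tail ⟨hx.1, hy.1, hxy⟩)) h1 h3
        rwa [Finset.union_sdiff_of_subset hPX] at this
      · have l1 : Real.log #P ≤ Real.log #X :=
          Real.log_le_log (by exact_mod_cast hp1) (by exact_mod_cast Finset.card_le_card hPX)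
        have l2 : Real.log #(X \ P) ≤ Real.log #X :=
          Real.log_le_log (by exact_mod_cast hp2)
            (by exact_mod_cast Finset.card_le_card sdiff_subset)
        push_cast
        rw [← hcard]
        rw [← hcard] at l1 l2
        push_cast at *
        calc (c:ℝ) + d ≤ K * #P * Real.log #P + K * #(X \ P) * Real.log #(X \ P) := by linarith
          _ ≤ K * #P * Real.log (#(X \ P) + #P) + K * #(X \ P) * Real.log (#(X \ P) + #P) := by
            gcongr
          _ = _ := by ring
    · -- connected
      have hA' : 120 * ∑ u ∈ X, tdeg τ X u ≤ (κ - 1) ^ 2 := by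
        refine le_trans ?_ hA
        gcongr with u hu
        calc ∑ u ∈ X, tdeg τ X u ≤ ∑ u ∈ X, tdeg τ X0 u := by
              refine Finset.sum_le_sum fun u _ => ?_
              unfold tdeg
              exact Finset.sum_le_sum_of_subset_of_nonneg hX0 (fun _ _ _ => by positivity)
          _ ≤ _ := Finset.sum_le_sum_of_subset_of_nonneg hX0 (fun _ _ _ => tdeg_nonneg _ _ _)
      set q := #X with hq
      have hq0 : 0 < q := hXne.card_pos
      set R := q * (k + 2) with hR
      have hR1 : q ≤ R := Nat.le_mul_of_pos_right _ (by omega)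
      have hRq : (q:ℝ) ≤ R := by exact_mod_cast hR1
      have hR0 : (0:ℝ) < R := by linarith
      obtain ⟨l, hl1, hl2⟩ := flow_nat τ hs hK X hXne hc κ hκ hA' (8 * R) (by linarith)
      have hlogX : Real.log q - Real.log 2 = Real.log (q / 2) := by
        rw [Real.log_div (by positivity) (by norm_num)]
      by_cases hbig : ∃ v ∈ X, q < 2 * #(Bs τ l X v R)
      · obtain ⟨v, hv, hvB⟩ := hbig
        obtain ⟨r, hr1, hr2, hr3⟩ := case_big hs l X hc κ hκ R (by omega) hl1 hsmall.le hl2 v hv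
        set C := Cs τ l X v r with hC
        set B := Bs τ l X v r with hB
        have hBC : B ⊆ C := Bs_sub_Cs l X v r
        have hCX : C ⊆ X := Cs_sub l X v r
        have hB2 : q < 2 * #B := lt_of_lt_of_le hvB (by
          gcongr; exact Bs_mono l subset_rfl v hr1)
        have hcard : #(X \ C) + #C = q := Finset.card_sdiff_add_card_eq_card hCX
        have hBCc := Finset.card_le_card hBC
        have hOp : 0 < #(X \ C) := hr2.card_pos
        obtain ⟨c, h1, h2⟩ := ih B ((hBC.trans hCX).trans hX0) (by omega)
        obtain ⟨d, h3, h4⟩ := ih (X \ C) (sdiff_subset.trans hX0) (by omega)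
        obtain ⟨e, h5, h6⟩ := elim_split hs l X v r h1 h3
        refine ⟨e, h5, ?_⟩
        have l1 : Real.log #B ≤ Real.log q :=
          Real.log_le_log (by exact_mod_cast (by omega : 0 < #B))
            (by exact_mod_cast (by omega : #B ≤ q))
        have l2 : Real.log #(X \ C) ≤ Real.log q - Real.log 2 := by
          rw [hlogX]
          apply Real.log_le_log (by exact_mod_cast hOp)
          rw [le_div_iff₀ (by norm_num)]
          exact_mod_cast (by omega : #(X \ C) * 2 ≤ q)
        have l3 : 0 ≤ Real.log q := Real.log_natCast_nonneg _
        have h6' : (e:ℝ) ≤ c + d + #(C \ B) * q := by exact_mod_cast h6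
        have h7 : (#B : ℝ) + #(X \ C) ≤ q := by exact_mod_cast (by omega : #B + #(X \ C) ≤ q)
        calc (e:ℝ) ≤ K * #B * Real.log #B + K * #(X \ C) * Real.log #(X \ C) +
              4 * κ * #(X \ C) := by linarith
          _ ≤ K * #B * Real.log q + K * #(X \ C) * (Real.log q - Real.log 2) +
              4 * κ * #(X \ C) := by gcongr
          _ = K * (#B + #(X \ C)) * Real.log q + #(X \ C) * (4 * κ - K * Real.log 2) := by ring
          _ ≤ K * (#B + #(X \ C)) * Real.log q + 0 := by
              gcongr
              apply mul_nonpos_of_nonneg_of_nonpos (by positivity)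
              linarith
          _ ≤ K * q * Real.log q := by
              rw [add_zero]; gcongr
      · push Not at hbig
        have hLpos : 0 < ∑ u ∈ X, l u := by
          by_contra! h0
          have h0' : ∑ u ∈ X, l u = 0 := by omega
          have := hl2 (fun _ _ => X) (fun s hs t ht => ⟨subset_rfl, hc, hs, ht⟩)
          simp only [h0', Finset.sum_const_zero, Nat.cast_zero] at this
          have h8 : 0 < 8 * (R:ℝ) * (q:ℝ)^2 := by positivity
          linarith
        have hKb : 0 ≤ K * (Real.log q - Real.log 2) := by
          apply mul_nonneg hKpos.le
          have : Real.log 2 ≤ Real.log q := Real.log_le_log (by norm_num) (by linarith)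
          linarith
        obtain ⟨c, h1, h2⟩ := case_small hs l X hLpos k q hk' hq0 (K * (Real.log q - Real.log 2)) (by
          intro v hv B hB
          have hc1 := Finset.card_le_card hB
          rw [← hR] at hc1
          have hc2 := hbig v hv
          have hBX : B ⊆ X := hB.trans ((Bs_sub_Cs l X v _).trans (Cs_sub l X v _))
          obtain ⟨c, h1, h2⟩ := ih B (hBX.trans hX0) (by
            have : #B * 2 ≤ q := by omega
            omega)
          refine ⟨c, h1, h2.trans ?_⟩
          rcases Nat.eq_zero_or_pos #B with h0 | h0
          · simp [h0]
          · have l2 : Real.log #B ≤ Real.log q - Real.log 2 := by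
              rw [hlogX]
              apply Real.log_le_log (by exact_mod_cast h0)
              rw [le_div_iff₀ (by norm_num)]
              exact_mod_cast (by omega : #B * 2 ≤ q)
            calc K * #B * Real.log #B ≤ K * #B * (Real.log q - Real.log 2) := by gcongr
              _ = _ := by ring) hKb q X subset_rfl le_rfl
        refine ⟨c, h1, h2.trans ?_⟩
        set L : ℕ := ∑ u ∈ X, l u with hL
        have e1 : (q:ℝ) / q * (L + q * (L / (q:ℝ))) = 2 * L := by
          field_simp; ring
        rw [← hq, e1]
        have e2 : (L:ℝ) ≤ κ * (8 * (q * (k+2))) := by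
          have : (R:ℝ) = q * (k+2) := by rw [hR]; push_cast; ring
          rw [← this]; exact hl1
        have e3 : q * (16 * κ * (k+2)) ≤ q * (K * Real.log 2) := by gcongr
        nlinarith
end region


lemma forest_extend {a b : ℤ × ℤ} (p : gridG.Walk a b) (F : SimpleGraph (ℤ × ℤ))
    (hF : F.IsAcyclic) :
    ∃ F2 : SimpleGraph (ℤ × ℤ), F ≤ F2 ∧ F2.IsAcyclic ∧ F2.Reachable a b ∧
      ∀ x y, F2.Adj x y → F.Adj x y ∨ (gridG.Adj x y ∧ x ∈ p.support ∧ y ∈ p.support) := by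
  induction p with
  | nil => exact ⟨F, le_rfl, hF, SimpleGraph.Reachable.refl _, fun x y h => Or.inl h⟩
  | @cons u v w h p ih =>
    obtain ⟨F2, h1, h2, h3, h4⟩ := ih
    by_cases hr : F2.Reachable u v
    · refine ⟨F2, h1, h2, hr.trans h3, fun x y hxy => ?_⟩
      rcases h4 x y hxy with h | ⟨g1, g2, g3⟩
      · exact Or.inl h
      · exact Or.inr ⟨g1, by simp [g2], by simp [g3]⟩
    · refine ⟨F2 ⊔ SimpleGraph.edge u v, h1.trans le_sup_left,
        h2.sup_edge_of_not_reachable hr, ?_, ?_⟩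
      · have : (F2 ⊔ SimpleGraph.edge u v).Adj u v := by
          rw [SimpleGraph.sup_adj, SimpleGraph.edge_adj]
          exact Or.inr ⟨Or.inl ⟨rfl, rfl⟩, h.ne⟩
        exact this.reachable.trans (h3.mono le_sup_left)
      · intro x y hxy
        have hv := p.start_mem_support
        rw [SimpleGraph.sup_adj, SimpleGraph.edge_adj] at hxy
        rcases hxy with hxy | ⟨⟨rfl, rfl⟩ | ⟨rfl, rfl⟩, -⟩
        · rcases h4 x y hxy with h | ⟨g1, g2, g3⟩
          · exact Or.inl h
          · exact Or.inr ⟨g1, by simp [g2], by simp [g3]⟩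
        · exact Or.inr ⟨h, by simp, by simp [hv]⟩
        · exact Or.inr ⟨h.symm, by simp [hv], by simp⟩

section forest
variable {E : Type*} [DecidableEq E] {a b : E → ℤ × ℤ} (Z : ∀ e, gridG.Walk (a e) (b e))

/-- touching relation of lattice strings -/
def touch (e f : E) : Prop := ∃ x ∈ (Z e).support, x ∈ (Z f).support

/-- cells used by a set of strings -/
def cellsOf (X : Finset E) : Set (ℤ × ℤ) := {x | ∃ e ∈ X, x ∈ (Z e).support}

lemma walk_stay {F : SimpleGraph (ℤ × ℤ)} {S : Set (ℤ × ℤ)}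
    (hF : ∀ x y, F.Adj x y → x ∈ S → y ∈ S) {x y : ℤ × ℤ} (p : F.Walk x y) (hx : x ∈ S) :
    ∀ z ∈ p.support, z ∈ S := by
  induction p with
  | nil => simpa using hx
  | cons h p ih =>
    intro z hz
    rw [SimpleGraph.Walk.support_cons, List.mem_cons] at hz
    rcases hz with rfl | hz
    · exact hx
    · exact ih (hF _ _ h hx) z hz

/-- supports of two paths meet -/
def meets {F : SimpleGraph (ℤ × ℤ)} (P : ∀ e : E, F.Path (a e) (b e)) (e f : E) : Prop :=
  ∃ x ∈ (P e).1.support, x ∈ (P f).1.support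

open Classical in
theorem forest_exists (X : Finset E) (c : ℕ) (h : Elim (touch Z) X c) :
    ∀ F0 : SimpleGraph (ℤ × ℤ), F0.IsAcyclic →
      (∀ x y, F0.Adj x y → x ∉ cellsOf Z X) →
      ∃ F : SimpleGraph (ℤ × ℤ), F0 ≤ F ∧ F.IsAcyclic ∧
        (∀ x y, F.Adj x y → F0.Adj x y ∨ (gridG.Adj x y ∧ x ∈ cellsOf Z X ∧ y ∈ cellsOf Z X)) ∧
        ∃ S : E → Set (ℤ × ℤ),
          (∀ e ∈ X, ∃ p : F.Path (a e) (b e), S e = {x | x ∈ p.1.support} ∧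
            S e ⊆ cellsOf Z X) ∧
          #{p ∈ X ×ˢ X | p.1 ≠ p.2 ∧ (S p.1 ∩ S p.2).Nonempty} ≤ 2 * c := by
  induction h with
  | empty =>
    intro F0 h1 h2
    exact ⟨F0, le_rfl, h1, fun x y h => Or.inl h, fun _ => ∅, by simp, by simp⟩
  | add X s c hs hX ih =>
    intro F0 h1 h2
    have hmono : cellsOf Z X ⊆ cellsOf Z (insert s X) := by
      rintro x ⟨e, he, hx⟩; exact ⟨e, by simp [he], hx⟩
    have hmono2 : ∀ x ∈ (Z s).support, x ∈ cellsOf Z (insert s X) := fun x hx => ⟨s, by simp, hx⟩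
    obtain ⟨F1, g1, g2, g3, S, g4, g5⟩ := ih F0 h1 (fun x y h hx => h2 x y h (hmono hx))
    obtain ⟨F2, f1, f2, f3, f4⟩ := forest_extend (Z s) F1 g2
    have hF2 : ∀ x y, F2.Adj x y → F0.Adj x y ∨
        (gridG.Adj x y ∧ x ∈ cellsOf Z (insert s X) ∧ y ∈ cellsOf Z (insert s X)) := by
      intro x y hxy
      rcases f4 x y hxy with h | h
      · rcases g3 x y h with h | h
        · exact Or.inl h
        · exact Or.inr ⟨h.1, hmono h.2.1, hmono h.2.2⟩
      · exact Or.inr ⟨h.1, hmono2 _ h.2.1, hmono2 _ h.2.2⟩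
    obtain ⟨q⟩ := f3
    refine ⟨F2, g1.trans f1, f2, hF2, fun e => if e = s then {x | x ∈ q.toPath.1.support} else S e,
      ?_, ?_⟩
    · intro e he
      by_cases hes : e = s
      · subst hes
        refine ⟨q.toPath, by simp, ?_⟩
        simp only [if_true]
        refine walk_stay (fun x y hxy hx => ?_) _ (hmono2 _ (Z e).start_mem_support)
        rcases hF2 x y hxy with h | h
        · exact absurd hx (h2 x y h)
        · exact h.2.2
      · obtain ⟨p, p1, p2⟩ := g4 e ((mem_insert.1 he).resolve_left hes)
        refine ⟨⟨p.1.mapLe f1, p.2.mapLe f1⟩, ?_, ?_⟩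
        · simp only [if_neg hes, p1, SimpleGraph.Walk.support_mapLe_eq_support]
        · simp only [if_neg hes]; exact p2.trans hmono
    · have hsub : {p ∈ insert s X ×ˢ insert s X | p.1 ≠ p.2 ∧
          ((if p.1 = s then {x | x ∈ q.toPath.1.support} else S p.1) ∩
          (if p.2 = s then {x | x ∈ q.toPath.1.support} else S p.2)).Nonempty} ⊆
          {p ∈ X ×ˢ X | p.1 ≠ p.2 ∧ (S p.1 ∩ S p.2).Nonempty} ∪
          (X.image (fun x => (s, x)) ∪ X.image (fun x => (x, s))) := by
        rintro ⟨e, f⟩ hp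
        simp only [mem_filter, mem_product, mem_insert, mem_union, mem_image, Prod.mk.injEq] at hp ⊢
        obtain ⟨⟨he, hf⟩, hne, hp⟩ := hp
        by_cases h1 : e = s
        · by_cases h2 : f = s
          · exact absurd (h1.trans h2.symm) hne
          · right; left; exact ⟨f, hf.resolve_left h2, h1.symm, rfl⟩
        · by_cases h2 : f = s
          · right; right; exact ⟨e, he.resolve_left h1, rfl, h2.symm⟩
          · left
            rw [if_neg h1, if_neg h2] at hp
            exact ⟨⟨he.resolve_left h1, hf.resolve_left h2⟩, hne, hp⟩
      refine le_trans (Finset.card_le_card hsub) ?_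
      have c2 := Finset.card_union_le {p ∈ X ×ˢ X | p.1 ≠ p.2 ∧ (S p.1 ∩ S p.2).Nonempty}
          (X.image (fun x => (s, x)) ∪ X.image (fun x => (x, s)))
      have c3 := Finset.card_union_le (X.image (fun x => (s, x))) (X.image (fun x => (x, s)))
      have c4 : #(X.image (fun x => (s, x))) ≤ #X := card_image_le
      have c5 : #(X.image (fun x => (x, s))) ≤ #X := card_image_le
      omega
  | union A B c d hd hn hA hB ihA ihB =>
    intro F0 h1 h2
    have mA : cellsOf Z A ⊆ cellsOf Z (A ∪ B) := by
      rintro x ⟨e, he, hx⟩; exact ⟨e, by simp [he], hx⟩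
    have mB : cellsOf Z B ⊆ cellsOf Z (A ∪ B) := by
      rintro x ⟨e, he, hx⟩; exact ⟨e, by simp [he], hx⟩
    have hdis : ∀ x, x ∈ cellsOf Z A → x ∉ cellsOf Z B := by
      rintro x ⟨e, he, hx⟩ ⟨f, hf, hx'⟩
      exact hn e he f hf ⟨x, hx, hx'⟩
    obtain ⟨F1, g1, g2, g3, S, g4, g5⟩ := ihA F0 h1 (fun x y h hx => h2 x y h (mA hx))
    obtain ⟨F2, f1, f2, f3, T, f4, f5⟩ := ihB F1 g2 (fun x y h hx => by
      rcases g3 x y h with h | h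
      · exact h2 x y h (mB hx)
      · exact hdis x h.2.1 hx)
    refine ⟨F2, g1.trans f1, f2, ?_, fun e => if e ∈ A then S e else T e, ?_, ?_⟩
    · intro x y hxy
      rcases f3 x y hxy with h | h
      · rcases g3 x y h with h | h
        · exact Or.inl h
        · exact Or.inr ⟨h.1, mA h.2.1, mA h.2.2⟩
      · exact Or.inr ⟨h.1, mB h.2.1, mB h.2.2⟩
    · intro e he
      by_cases heA : e ∈ A
      · obtain ⟨p, p1, p2⟩ := g4 e heA
        refine ⟨⟨p.1.mapLe f1, p.2.mapLe f1⟩, ?_, ?_⟩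
        · simp only [if_pos heA, p1, SimpleGraph.Walk.support_mapLe_eq_support]
        · simp only [if_pos heA]; exact p2.trans mA
      · obtain ⟨p, p1, p2⟩ := f4 e ((mem_union.1 he).resolve_left heA)
        exact ⟨p, by simp only [if_neg heA, p1], by simp only [if_neg heA]; exact p2.trans mB⟩
    · have hsub : {p ∈ (A ∪ B) ×ˢ (A ∪ B) | p.1 ≠ p.2 ∧
          ((if p.1 ∈ A then S p.1 else T p.1) ∩ (if p.2 ∈ A then S p.2 else T p.2)).Nonempty} ⊆
          {p ∈ A ×ˢ A | p.1 ≠ p.2 ∧ (S p.1 ∩ S p.2).Nonempty} ∪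
          {p ∈ B ×ˢ B | p.1 ≠ p.2 ∧ (T p.1 ∩ T p.2).Nonempty} := by
        rintro ⟨e, f⟩ hp
        simp only [mem_filter, mem_product, mem_union] at hp ⊢
        obtain ⟨⟨he, hf⟩, hne, hp⟩ := hp
        by_cases h1 : e ∈ A <;> by_cases h2 : f ∈ A
        · simp only [if_pos h1, if_pos h2] at hp
          exact Or.inl ⟨⟨h1, h2⟩, hne, hp⟩
        · simp only [if_pos h1, if_neg h2] at hp
          obtain ⟨x, hx, hx'⟩ := hp
          obtain ⟨_, _, p1⟩ := g4 e h1
          obtain ⟨_, _, p2⟩ := f4 f (hf.resolve_left h2)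
          exact absurd (p2 hx') (hdis x (p1 hx))
        · simp only [if_neg h1, if_pos h2] at hp
          obtain ⟨x, hx, hx'⟩ := hp
          obtain ⟨_, _, p1⟩ := g4 f h2
          obtain ⟨_, _, p2⟩ := f4 e (he.resolve_left h1)
          exact absurd (p2 hx) (hdis x (p1 hx'))
        · simp only [if_neg h1, if_neg h2] at hp
          exact Or.inr ⟨⟨he.resolve_left h1, hf.resolve_left h2⟩, hne, hp⟩
      refine le_trans (Finset.card_le_card hsub) ?_
      have c2 := Finset.card_union_le {p ∈ A ×ˢ A | p.1 ≠ p.2 ∧ (S p.1 ∩ S p.2).Nonempty}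
          {p ∈ B ×ˢ B | p.1 ≠ p.2 ∧ (T p.1 ∩ T p.2).Nonempty}
      omega
end forest

/-- in a forest, sections of paths with the same ends agree -/
lemma section_eq {V : Type*} {F : SimpleGraph V} (hF : F.IsAcyclic) {a b c d : V} {p : F.Walk a b}
    {q : F.Walk c d} (hp : p.IsPath) (hq : q.IsPath) {i j i' j' : ℕ} (hij : i ≤ j)
    (hj : j ≤ p.length) (hij' : i' ≤ j') (hj' : j' ≤ q.length)
    (h1 : p.getVert i = q.getVert i') (h2 : p.getVert j = q.getVert j') :
    j - i = j' - i' ∧ ∀ t ≤ j - i, p.getVert (i + t) = q.getVert (i' + t) := by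
  have e1 : (p.drop i).getVert (j - i) = p.getVert j := by
    rw [SimpleGraph.Walk.drop_getVert]; congr 1; omega
  have e2 : (q.drop i').getVert (j' - i') = p.getVert j := by
    rw [SimpleGraph.Walk.drop_getVert, h2]; congr 1; omega
  let p1 : F.Walk (p.getVert i) (p.getVert j) := ((p.drop i).take (j - i)).copy rfl e1
  let q1 : F.Walk (p.getVert i) (p.getVert j) := ((q.drop i').take (j' - i')).copy h1.symm e2
  have hp1 : p1.IsPath := by
    simp only [p1, SimpleGraph.Walk.isPath_copy]; exact (hp.drop i).take _
  have hq1 : q1.IsPath := by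
    simp only [q1, SimpleGraph.Walk.isPath_copy]; exact (hq.drop i').take _
  have heq : p1 = q1 := congrArg Subtype.val (hF.path_unique ⟨p1, hp1⟩ ⟨q1, hq1⟩)
  have l1 : p1.length = j - i := by
    simp only [p1, SimpleGraph.Walk.length_copy, SimpleGraph.Walk.take_length,
      SimpleGraph.Walk.drop_length]; omega
  have l2 : q1.length = j' - i' := by
    simp only [q1, SimpleGraph.Walk.length_copy, SimpleGraph.Walk.take_length,
      SimpleGraph.Walk.drop_length]; omega
  have hl : j - i = j' - i' := by rw [← l1, ← l2, heq]
  refine ⟨hl, fun t ht => ?_⟩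
  have g1 : p1.getVert t = p.getVert (i + t) := by
    simp only [p1, SimpleGraph.Walk.getVert_copy, SimpleGraph.Walk.take_getVert,
      SimpleGraph.Walk.drop_getVert]; congr 1; omega
  have g2 : q1.getVert t = q.getVert (i' + t) := by
    simp only [q1, SimpleGraph.Walk.getVert_copy, SimpleGraph.Walk.take_getVert,
      SimpleGraph.Walk.drop_getVert]; congr 1; omega
  rw [← g1, ← g2, heq]

lemma middle_good_aux {V : Type*} {F : SimpleGraph V} (hF : F.IsAcyclic) {a b c d : V}
    {p : F.Walk a b} {q : F.Walk c d} (hp : p.IsPath) (hq : q.IsPath) {i j k i' j' k' : ℕ}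
    (hij : i < j) (hjk : j < k) (hk : k ≤ p.length) (hi' : i' ≤ q.length)
    (hj' : j' ≤ q.length) (hk' : k' ≤ q.length) (h1 : p.getVert i = q.getVert i')
    (h2 : p.getVert j = q.getVert j') (h3 : p.getVert k = q.getVert k') (hik : i' ≤ k') :
    0 < j' ∧ j' < q.length ∧ p.getVert (j - 1) = q.getVert (j' - 1) ∧
      p.getVert (j + 1) = q.getVert (j' + 1) := by
  obtain ⟨hl, hs⟩ := section_eq hF hp hq (hij.trans hjk).le hk hik hk' h1 h3
  have e1 := hs (j - i) (by omega)
  have e2 := hs (j - 1 - i) (by omega)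
  have e3 := hs (j + 1 - i) (by omega)
  have e0 : i' + (j - i) = j' := by
    apply hq.getVert_injOn (by simp; omega) (by simpa using hj')
    rw [← e1, ← h2]; congr 1; omega
  refine ⟨by omega, by omega, ?_, ?_⟩
  · convert e2 using 2 <;> omega
  · convert e3 using 2 <;> omega

lemma middle_good {V : Type*} {F : SimpleGraph V} (hF : F.IsAcyclic) {a b c d : V}
    {p : F.Walk a b} {q : F.Walk c d} (hp : p.IsPath) (hq : q.IsPath) {i j k i' j' k' : ℕ}
    (hij : i < j) (hjk : j < k) (hk : k ≤ p.length) (hi' : i' ≤ q.length)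
    (hj' : j' ≤ q.length) (hk' : k' ≤ q.length) (h1 : p.getVert i = q.getVert i')
    (h2 : p.getVert j = q.getVert j') (h3 : p.getVert k = q.getVert k') :
    0 < j' ∧ j' < q.length ∧ ((p.getVert (j - 1) = q.getVert (j' - 1) ∧
      p.getVert (j + 1) = q.getVert (j' + 1)) ∨ (p.getVert (j - 1) = q.getVert (j' + 1) ∧
      p.getVert (j + 1) = q.getVert (j' - 1))) := by
  rcases le_total i' k' with h | h
  · have := middle_good_aux hF hp hq hij hjk hk hi' hj' hk' h1 h2 h3 h
    tauto
  · have := middle_good_aux hF hp hq.reverse (i' := q.length - i') (j' := q.length - j')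
      (k' := q.length - k') hij hjk hk (by simp) (by simp) (by simp)
      (by rw [SimpleGraph.Walk.getVert_reverse, h1]; congr 1; omega)
      (by rw [SimpleGraph.Walk.getVert_reverse, h2]; congr 1; omega)
      (by rw [SimpleGraph.Walk.getVert_reverse, h3]; congr 1; omega) (by omega)
    rw [SimpleGraph.Walk.getVert_reverse, SimpleGraph.Walk.getVert_reverse,
      SimpleGraph.Walk.length_reverse] at this
    obtain ⟨t1, t2, t3, t4⟩ := this
    refine ⟨by omega, by omega, Or.inr ⟨?_, ?_⟩⟩
    · rw [t3]; congr 1; omega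
    · rw [t4]; congr 1; omega


section k5t
variable {E : Type*} {a b : E → ℤ × ℤ} (Z : ∀ e, gridG.Walk (a e) (b e))

lemma touch_symm (e f : E) (h : touch Z e f) : touch Z f e := by
  obtain ⟨x, h1, h2⟩ := h; exact ⟨x, h2, h1⟩

lemma walk_in (e : E) {x y : ℤ × ℤ} (hx : x ∈ (Z e).support) (hy : y ∈ (Z e).support) :
    ∃ p : gridG.Walk x y, ∀ z ∈ p.support, z ∈ (Z e).support := by
  refine ⟨((Z e).takeUntil x hx).reverse.append ((Z e).takeUntil y hy), fun z hz => ?_⟩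
  rw [SimpleGraph.Walk.mem_support_append_iff, SimpleGraph.Walk.support_reverse,
    List.mem_reverse] at hz
  rcases hz with hz | hz
  · exact (Z e).support_takeUntil_subset_support hx hz
  · exact (Z e).support_takeUntil_subset_support hy hz

lemma tconn_walk {U : Finset E} {x y : E}
    (h : Relation.ReflTransGen (fun x y => x ∈ U ∧ y ∈ U ∧ touch Z x y) x y) (hx : x ∈ U) :
    ∃ p : gridG.Walk (a x) (a y), ∀ z ∈ p.support, ∃ u ∈ U, z ∈ (Z u).support := by
  induction h with
  | refl => exact ⟨SimpleGraph.Walk.nil, fun z hz => ⟨x, hx, by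
      rw [SimpleGraph.Walk.support_nil, List.mem_singleton] at hz
      rw [hz]; exact (Z x).start_mem_support⟩⟩
  | @tail u w _ h2 ih =>
    obtain ⟨p, hp⟩ := ih
    obtain ⟨hu, hw, c, c1, c2⟩ := h2
    obtain ⟨q, hq⟩ := walk_in Z u (Z u).start_mem_support c1
    obtain ⟨r, hr⟩ := walk_in Z w c2 (Z w).start_mem_support
    refine ⟨p.append (q.append r), fun z hz => ?_⟩
    rw [SimpleGraph.Walk.mem_support_append_iff, SimpleGraph.Walk.mem_support_append_iff] at hz
    rcases hz with hz | hz | hz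
    · exact hp z hz
    · exact ⟨u, hu, hq z hz⟩
    · exact ⟨w, hw, hr z hz⟩

theorem K5Prop_touch : K5Prop (touch Z) := by
  intro v U h
  have : ∀ i j, ∃ p : gridG.Walk (a (v i)) (a (v j)), ∀ z ∈ p.support, ∃ u ∈ U i j,
      z ∈ (Z u).support := fun i j => tconn_walk Z ((h i j).1 _ (h i j).2.1 _ (h i j).2.2) (h i j).2.1
  choose P hP using this
  obtain ⟨i, j, k, l, h1, h2, h3, h4, h5, h6, x, hx, hx'⟩ := grid_K5 (fun i => a (v i)) P
  obtain ⟨u, hu, hxu⟩ := hP i j x hx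
  obtain ⟨w, hw, hxw⟩ := hP k l x hx'
  exact ⟨i, j, k, l, h1, h2, h3, h4, h5, h6, u, hu, w, hw, x, hxu, hxw⟩
end k5t


lemma gridG_cases {y z : ℤ × ℤ} (h : gridG.Adj y z) :
    z = (y.1 + 1, y.2) ∨ z = (y.1 - 1, y.2) ∨ z = (y.1, y.2 + 1) ∨ z = (y.1, y.2 - 1) := by
  obtain ⟨a, b⟩ := y
  obtain ⟨c, d⟩ := z
  simp only [gridG, Prod.mk.injEq] at h ⊢
  omega

/-- the point where a curve with offset `δ` passes from cell `z` to cell `z'` -/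
noncomputable def gate (z z' : ℤ × ℤ) (δ : ℝ) : ℝ × ℝ :=
  (((z.1 : ℝ) + z'.1) / 2 - δ * ((z'.2 : ℝ) - z.2), ((z.2 : ℝ) + z'.2) / 2 + δ * ((z'.1 : ℝ) - z.1))

/-- on the line of a chord -/
def onChord (y0 y1 y2 : ℤ × ℤ) (δ : ℝ) (x : ℝ × ℝ) : Prop :=
  (x.2 - (gate y0 y1 δ).2) * ((y2.1 : ℝ) - y0.1) = (x.1 - (gate y0 y1 δ).1) * ((y2.2 : ℝ) - y0.2)

/-- strictly inside a cell -/
def inCell (y : ℤ × ℤ) (x : ℝ × ℝ) : Prop :=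
  y.1 - 1 / 2 < x.1 ∧ x.1 < y.1 + 1 / 2 ∧ y.2 - 1 / 2 < x.2 ∧ x.2 < y.2 + 1 / 2

lemma chord_type {y0 y1 y2 : ℤ × ℤ} (h0 : gridG.Adj y1 y0) (h2 : gridG.Adj y1 y2) (hne : y0 ≠ y2)
    {δ : ℝ} (hd : 0 < δ) (hd' : δ < 1 / 4) {x : ℝ × ℝ}
    (hx : x ∈ segment ℝ (gate y0 y1 δ) (gate y1 y2 δ)) :
    x = gate y0 y1 δ ∨ x = gate y1 y2 δ ∨ (inCell y1 x ∧ onChord y0 y1 y2 δ x) := by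
  rw [segment_eq_image] at hx
  obtain ⟨t, ⟨ht0, ht1⟩, rfl⟩ := hx
  rcases ht0.eq_or_lt with rfl | ht0
  · left; simp
  rcases ht1.eq_or_lt with rfl | ht1
  · right; left; simp
  right; right
  obtain ⟨a, b⟩ := y1
  have e1 : 0 < t * δ := by positivity
  have e2 : t * δ < t * (1/4) := by gcongr
  have e3 : 0 < (1 - t) * δ := mul_pos (by linarith) hd
  have e4 : (1 - t) * δ < (1 - t) * (1/4) := mul_lt_mul_of_pos_left hd' (by linarith)
  rcases gridG_cases h0 with rfl | rfl | rfl | rfl <;>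
    rcases gridG_cases h2 with rfl | rfl | rfl | rfl <;>
    first
    | exact absurd rfl hne
    | (simp only [inCell, onChord, gate, Prod.fst_add, Prod.snd_add, Prod.smul_fst, Prod.smul_snd,
        smul_eq_mul]
       push_cast
       refine ⟨⟨?_, ?_, ?_, ?_⟩, by ring⟩ <;> linarith)

lemma chord_normal {y0 y1 y2 : ℤ × ℤ} (h0 : gridG.Adj y1 y0) (h2 : gridG.Adj y1 y2)
    (hne : y0 ≠ y2) {δ : ℝ} {p : ℝ × ℝ} : ∃ s : ℝ, |s| = |δ| ∧ ∃ A B K : ℝ,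
    ((A = 0 ∧ B = 1 ∧ K = 0) ∨ (A = 1 ∧ B = 0 ∧ K = 0) ∨ (A = -1 ∧ B = 1 ∧ K = 1 / 2) ∨
    (A = -1 ∧ B = 1 ∧ K = -1 / 2) ∨ (A = 1 ∧ B = 1 ∧ K = 1 / 2) ∨
    (A = 1 ∧ B = 1 ∧ K = -1 / 2)) ∧
    ∀ p : ℝ × ℝ, onChord y0 y1 y2 δ p → A * (p.1 - y1.1) + B * (p.2 - y1.2) = K + s := by
  obtain ⟨a, b⟩ := y1
  have hl : ∀ (s : ℝ) (A B K : ℝ), |s| = |δ| → 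
    ((A = 0 ∧ B = 1 ∧ K = 0) ∨ (A = 1 ∧ B = 0 ∧ K = 0) ∨ (A = -1 ∧ B = 1 ∧ K = 1 / 2) ∨
    (A = -1 ∧ B = 1 ∧ K = -1 / 2) ∨ (A = 1 ∧ B = 1 ∧ K = 1 / 2) ∨
    (A = 1 ∧ B = 1 ∧ K = -1 / 2)) → 
    (∀ p : ℝ × ℝ, onChord y0 (a, b) y2 δ p → A * (p.1 - a) + B * (p.2 - b) = K + s) → 
    ∃ s : ℝ, |s| = |δ| ∧ ∃ A B K : ℝ,
    ((A = 0 ∧ B = 1 ∧ K = 0) ∨ (A = 1 ∧ B = 0 ∧ K = 0) ∨ (A = -1 ∧ B = 1 ∧ K = 1 / 2) ∨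
    (A = -1 ∧ B = 1 ∧ K = -1 / 2) ∨ (A = 1 ∧ B = 1 ∧ K = 1 / 2) ∨
    (A = 1 ∧ B = 1 ∧ K = -1 / 2)) ∧
    ∀ p : ℝ × ℝ, onChord y0 (a, b) y2 δ p → A * (p.1 - a) + B * (p.2 - b) = K + s :=
    fun s A B K h1 h2 h3 => ⟨s, h1, A, B, K, h2, h3⟩
  rcases gridG_cases h0 with rfl | rfl | rfl | rfl <;>
    rcases gridG_cases h2 with rfl | rfl | rfl | rfl <;>
    first
    | exact absurd rfl hne
    | (simp only [onChord, gate] at hl ⊢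
       push_cast at hl ⊢
       first
       | exact hl δ 0 1 0 rfl (by norm_num) (fun p hp => by linarith)
       | exact hl (-δ) 0 1 0 (abs_neg _) (by norm_num) (fun p hp => by linarith)
       | exact hl δ 1 0 0 rfl (by norm_num) (fun p hp => by linarith)
       | exact hl (-δ) 1 0 0 (abs_neg _) (by norm_num) (fun p hp => by linarith)
       | exact hl δ (-1) 1 (1/2) rfl (by norm_num) (fun p hp => by linarith)
       | exact hl (-δ) (-1) 1 (1/2) (abs_neg _) (by norm_num) (fun p hp => by linarith)
       | exact hl δ (-1) 1 (-1/2) rfl (by norm_num) (fun p hp => by linarith)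
       | exact hl (-δ) (-1) 1 (-1/2) (abs_neg _) (by norm_num) (fun p hp => by linarith)
       | exact hl δ (1) 1 (1/2) rfl (by norm_num) (fun p hp => by linarith)
       | exact hl (-δ) (1) 1 (1/2) (abs_neg _) (by norm_num) (fun p hp => by linarith)
       | exact hl δ (1) 1 (-1/2) rfl (by norm_num) (fun p hp => by linarith)
       | exact hl (-δ) (1) 1 (-1/2) (abs_neg _) (by norm_num) (fun p hp => by linarith))

lemma chord_chord {y0 y1 y2 z0 z2 : ℤ × ℤ} (h0 : gridG.Adj y1 y0) (h2 : gridG.Adj y1 y2)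
    (hne : y0 ≠ y2) (g0 : gridG.Adj y1 z0) (g2 : gridG.Adj y1 z2) (gne : z0 ≠ z2)
    {δ ε : ℝ} (hd : 0 < δ) (hd' : δ < 1 / 4) (he : 0 < ε) (he' : ε < 1 / 4) (hde : δ ≠ ε)
    {p q : ℝ × ℝ} (hp : onChord y0 y1 y2 δ p) (hq : onChord y0 y1 y2 δ q)
    (hp' : onChord z0 y1 z2 ε p) (hq' : onChord z0 y1 z2 ε q) : p = q := by
  obtain ⟨s, hs, A, B, K, hA, h⟩ := chord_normal h0 h2 hne (δ := δ) (p := p)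
  obtain ⟨t, ht, A', B', K', hA', h'⟩ := chord_normal g0 g2 gne (δ := ε) (p := p)
  have hst : s ≠ t := by
    rintro rfl
    rw [hs, abs_of_pos hd, abs_of_pos he] at ht
    exact hde ht
  rw [abs_of_pos hd] at hs
  rw [abs_of_pos he] at ht
  obtain ⟨s1, s2⟩ := abs_lt.1 (hs ▸ hd' : |s| < 1 / 4)
  obtain ⟨t1, t2⟩ := abs_lt.1 (ht ▸ he' : |t| < 1 / 4)
  have e1 := h p hp
  have e2 := h q hq
  have e3 := h' p hp'
  have e4 := h' q hq'
  obtain ⟨p1, p2⟩ := p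
  obtain ⟨q1, q2⟩ := q
  rw [Prod.mk.injEq]
  clear h h' hp hq hp' hq' hs ht
  dsimp only at e1 e2 e3 e4
  rcases hA with ⟨rfl, rfl, rfl⟩ | ⟨rfl, rfl, rfl⟩ | ⟨rfl, rfl, rfl⟩ | ⟨rfl, rfl, rfl⟩ |
    ⟨rfl, rfl, rfl⟩ | ⟨rfl, rfl, rfl⟩ <;>
  rcases hA' with ⟨rfl, rfl, rfl⟩ | ⟨rfl, rfl, rfl⟩ | ⟨rfl, rfl, rfl⟩ | ⟨rfl, rfl, rfl⟩ |
    ⟨rfl, rfl, rfl⟩ | ⟨rfl, rfl, rfl⟩ <;>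
  first
  | (constructor <;> linarith)
  | exact absurd (by linarith) hst

lemma chord_good {y0 y1 y2 z0 z2 : ℤ × ℤ} (h0 : gridG.Adj y1 y0) (h2 : gridG.Adj y1 y2)
    (hne : y0 ≠ y2) (hz : (y0 = z0 ∧ y2 = z2) ∨ (y0 = z2 ∧ y2 = z0))
    {δ ε : ℝ} (hd : 0 < δ) (he : 0 < ε) (hde : δ ≠ ε)
    {p : ℝ × ℝ} (hp : onChord y0 y1 y2 δ p) (hp' : onChord z0 y1 z2 ε p) : False := by
  obtain ⟨a, b⟩ := y1
  obtain ⟨p1, p2⟩ := p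
  rcases hde.lt_or_gt with hde | hde <;>
  rcases hz with ⟨rfl, rfl⟩ | ⟨rfl, rfl⟩ <;>
  rcases gridG_cases h0 with rfl | rfl | rfl | rfl <;>
    rcases gridG_cases h2 with rfl | rfl | rfl | rfl <;>
    first
    | exact absurd rfl hne
    | (simp only [onChord, gate] at hp hp'
       push_cast at hp hp'
       linarith)


/-- lattice point as a point of the plane -/
noncomputable def toR (z : ℤ × ℤ) : ℝ × ℝ := ((z.1 : ℝ), (z.2 : ℝ))

/-- lattice box -/
def inBox (m : ℕ) (c z : ℤ × ℤ) : Prop :=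
  c.1 - m ≤ z.1 ∧ z.1 ≤ c.1 + m ∧ c.2 - m ≤ z.2 ∧ z.2 ≤ c.2 + m

lemma int_eq {a b : ℤ} (h1 : (a : ℝ) - b < 1) (h2 : (b : ℝ) - a < 1) : a = b := by
  have h1 : a - b < 1 := by exact_mod_cast h1
  have h2 : b - a < 1 := by exact_mod_cast h2
  omega

lemma norm_le_iff2 {x : ℝ × ℝ} {r : ℝ} : ‖x‖ ≤ r ↔ |x.1| ≤ r ∧ |x.2| ≤ r := by
  rw [Prod.norm_def, max_le_iff, Real.norm_eq_abs, Real.norm_eq_abs]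

lemma norm_lt_iff2 {x : ℝ × ℝ} {r : ℝ} : ‖x‖ < r ↔ |x.1| < r ∧ |x.2| < r := by
  rw [Prod.norm_def, max_lt_iff, Real.norm_eq_abs, Real.norm_eq_abs]

lemma inBox_norm {m : ℕ} {c z : ℤ × ℤ} (h : inBox m c z) : ‖toR z - toR c‖ ≤ m := by
  obtain ⟨h1, h2, h3, h4⟩ := h
  have h1 : (c.1 : ℝ) - m ≤ z.1 := by exact_mod_cast h1
  have h2 : (z.1 : ℝ) ≤ c.1 + m := by exact_mod_cast h2
  have h3 : (c.2 : ℝ) - m ≤ z.2 := by exact_mod_cast h3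
  have h4 : (z.2 : ℝ) ≤ c.2 + m := by exact_mod_cast h4
  rw [norm_le_iff2, abs_le, abs_le]
  simp only [toR, Prod.fst_sub, Prod.snd_sub]
  refine ⟨⟨?_, ?_⟩, ?_, ?_⟩ <;> linarith

lemma not_inBox_norm {m : ℕ} {c z : ℤ × ℤ} (h : ¬ inBox m c z) : (m : ℝ) + 1 ≤ ‖toR z - toR c‖ := by
  by_contra! hn
  apply h
  rw [norm_lt_iff2, abs_lt, abs_lt] at hn
  simp only [toR, Prod.fst_sub, Prod.snd_sub] at hn
  obtain ⟨⟨h1, h2⟩, h3, h4⟩ := hn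
  have h1 : -((m : ℤ) + 1) < z.1 - c.1 := by exact_mod_cast h1
  have h2 : z.1 - c.1 < (m : ℤ) + 1 := by exact_mod_cast h2
  have h3 : -((m : ℤ) + 1) < z.2 - c.2 := by exact_mod_cast h3
  have h4 : z.2 - c.2 < (m : ℤ) + 1 := by exact_mod_cast h4
  refine ⟨?_, ?_, ?_, ?_⟩ <;> omega

lemma far_box {m : ℕ} {c z : ℤ × ℤ} (h : ¬ inBox m c z) {x : ℝ × ℝ} (hx : ‖x - toR z‖ ≤ 1 / 2) :
    (m : ℝ) + 1 / 2 ≤ ‖x - toR c‖ := by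
  have h1 := not_inBox_norm h
  have h2 : ‖toR z - toR c‖ ≤ ‖x - toR z‖ + ‖x - toR c‖ := by
    have : toR z - toR c = (x - toR c) - (x - toR z) := by abel
    rw [this]; exact (norm_sub_le _ _).trans_eq (add_comm _ _)
  linarith

lemma gate_normal {z z' : ℤ × ℤ} (h : gridG.Adj z z') {δ : ℝ} (hd : 0 < δ) :
    ∃ n k : ℤ, ∃ s : ℝ, |s| = δ ∧
      (gate z z' δ = ((n : ℝ) + 1 / 2, (k : ℝ) + s) ∨ gate z z' δ = ((k : ℝ) + s, (n : ℝ) + 1 / 2)) := by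
  obtain ⟨a, b⟩ := z
  rcases gridG_cases h with rfl | rfl | rfl | rfl
  · refine ⟨a, b, δ, abs_of_pos hd, Or.inl ?_⟩
    simp only [gate, Prod.mk.injEq]; push_cast; constructor <;> ring
  · refine ⟨a - 1, b, -δ, by rw [abs_neg, abs_of_pos hd], Or.inl ?_⟩
    simp only [gate, Prod.mk.injEq]; push_cast; constructor <;> ring
  · refine ⟨b, a, -δ, by rw [abs_neg, abs_of_pos hd], Or.inr ?_⟩
    simp only [gate, Prod.mk.injEq]; push_cast; constructor <;> ring
  · refine ⟨b - 1, a, δ, abs_of_pos hd, Or.inr ?_⟩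
    simp only [gate, Prod.mk.injEq]; push_cast; constructor <;> ring

lemma gate_ne {z z' w w' : ℤ × ℤ} (h : gridG.Adj z z') (g : gridG.Adj w w') {δ ε : ℝ}
    (hd : 0 < δ) (hd' : δ < 1 / 4) (he : 0 < ε) (he' : ε < 1 / 4) (hde : δ ≠ ε) :
    gate z z' δ ≠ gate w w' ε := by
  obtain ⟨n, k, s, hs, h⟩ := gate_normal h hd
  obtain ⟨n', k', t, ht, h'⟩ := gate_normal g he
  have hst : s ≠ t := by rintro rfl; exact hde (hs.symm.trans ht)
  obtain ⟨s1, s2⟩ := abs_lt.1 (hs ▸ hd' : |s| < 1 / 4)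
  obtain ⟨t1, t2⟩ := abs_lt.1 (ht ▸ he' : |t| < 1 / 4)
  have key : (k : ℝ) + s ≠ k' + t := by
    intro hk
    have : k = k' := int_eq (by linarith) (by linarith)
    subst this
    exact hst (by linarith)
  have key2 : ∀ (n k : ℤ) (s : ℝ), -(1 / 4) < s → s < 1 / 4 → (n : ℝ) + 1 / 2 ≠ k + s := by
    intro n k s s1 s2 hk
    have : n = k := int_eq (by linarith) (by linarith)
    subst this
    linarith
  intro heq
  rcases h with h | h <;> rcases h' with h' | h' <;> rw [h, h', Prod.mk.injEq] at heq
  · exact key heq.2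
  · exact key2 _ _ _ t1 t2 heq.1
  · exact key2 _ _ _ t1 t2 heq.2
  · exact key heq.1

lemma gate_not_inCell {z z' y : ℤ × ℤ} (h : gridG.Adj z z') {δ : ℝ} (hd : 0 < δ) :
    ¬ inCell y (gate z z' δ) := by
  rintro ⟨h1, h2, h3, h4⟩
  have key : ∀ n k : ℤ, (n : ℝ) - 1 / 2 < k + 1 / 2 → (k : ℝ) + 1 / 2 < n + 1 / 2 → False := by
    intro n k h1 h2
    have h1 : (n : ℝ) < k + 1 := by linarith
    have h2 : (k : ℝ) < n := by linarith
    norm_cast at h1 h2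
    omega
  obtain ⟨n, k, s, hs, h | h⟩ := gate_normal h hd
  · rw [h] at h1 h2; exact key _ _ h1 h2
  · rw [h] at h3 h4; exact key _ _ h3 h4

lemma gate_not_int {z z' y : ℤ × ℤ} (h : gridG.Adj z z') {δ : ℝ} (hd : 0 < δ) :
    gate z z' δ ≠ toR y := by
  intro he
  apply gate_not_inCell h hd (y := y)
  rw [he]
  simp only [inCell, toR]
  refine ⟨?_, ?_, ?_, ?_⟩ <;> linarith

lemma gate_near {z z' : ℤ × ℤ} (h : gridG.Adj z z') {δ : ℝ} (hd : 0 < δ) (hd' : δ < 1 / 4) :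
    ‖gate z z' δ - toR z‖ ≤ 1 / 2 ∧ ‖gate z z' δ - toR z'‖ ≤ 1 / 2 := by
  obtain ⟨a, b⟩ := z
  rw [norm_le_iff2, norm_le_iff2, abs_le, abs_le, abs_le, abs_le]
  rcases gridG_cases h with rfl | rfl | rfl | rfl <;>
  · simp only [gate, toR, Prod.fst_sub, Prod.snd_sub]
    push_cast
    refine ⟨⟨⟨?_, ?_⟩, ?_, ?_⟩, ⟨?_, ?_⟩, ?_, ?_⟩ <;> linarith

lemma inCell_near {y : ℤ × ℤ} {x : ℝ × ℝ} (h : inCell y x) : ‖x - toR y‖ ≤ 1 / 2 := by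
  obtain ⟨h1, h2, h3, h4⟩ := h
  rw [norm_le_iff2, abs_le, abs_le]
  simp only [toR, Prod.fst_sub, Prod.snd_sub]
  refine ⟨⟨?_, ?_⟩, ?_, ?_⟩ <;> linarith

lemma inCell_inj {y z : ℤ × ℤ} {x : ℝ × ℝ} (h : inCell y x) (h' : inCell z x) : y = z := by
  obtain ⟨h1, h2, h3, h4⟩ := h
  obtain ⟨g1, g2, g3, g4⟩ := h'
  exact Prod.ext (int_eq (by linarith) (by linarith)) (int_eq (by linarith) (by linarith))

lemma inCell_self (y : ℤ × ℤ) : inCell y (toR y) := by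
  simp only [inCell, toR]
  refine ⟨?_, ?_, ?_, ?_⟩ <;> linarith

lemma radial_type {c g x : ℝ × ℝ} {R : ℝ} (hg : ‖g - c‖ = R) (hR : 0 < R) (hx : x ∈ segment ℝ c g) :
    x = g ∨ ‖x - c‖ < R := by
  rw [segment_eq_image'] at hx
  obtain ⟨t, ⟨ht0, ht1⟩, rfl⟩ := hx
  rcases ht1.eq_or_lt with rfl | ht1
  · left; simp
  · right
    simp only [add_sub_cancel_left, norm_smul, hg, Real.norm_eq_abs, abs_of_nonneg ht0]
    nlinarith

lemma radial_radial {c g g' x : ℝ × ℝ} {R : ℝ} (hg : ‖g - c‖ = R) (hg' : ‖g' - c‖ = R) (hR : 0 < R)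
    (hne : g ≠ g') (hx : x ∈ segment ℝ c g) (hx' : x ∈ segment ℝ c g') : x = c := by
  rw [segment_eq_image'] at hx hx'
  obtain ⟨t, ⟨ht0, ht1⟩, rfl⟩ := hx
  obtain ⟨s, ⟨hs0, hs1⟩, h⟩ := hx'
  simp only [add_right_inj] at h ⊢
  have h1 : s * R = t * R := by
    have := congrArg norm h
    rwa [norm_smul, norm_smul, hg, hg', Real.norm_eq_abs, Real.norm_eq_abs, abs_of_nonneg ht0,
      abs_of_nonneg hs0] at this
  have h2 : s = t := mul_right_cancel₀ hR.ne' h1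
  subst h2
  rw [add_eq_left]
  by_contra hs
  have hs : s ≠ 0 := by rintro rfl; simp at hs
  have := smul_right_injective _ hs h
  exact hne (sub_left_injective this).symm



lemma IsArc.of_path {x y : ℝ × ℝ} (γ : Path x y) : IsArc (Set.range γ) x y := by
  refine ⟨γ.extend, γ.continuous_extend.continuousOn, ?_, by simp, by simp⟩
  ext z
  constructor
  · rintro ⟨t, rfl⟩
    exact ⟨t, t.2, by simp⟩
  · rintro ⟨t, ht, rfl⟩
    exact ⟨⟨t, ht⟩, (γ.extend_apply ht).symm⟩

lemma IsArc.to_path {c : Set (ℝ × ℝ)} {x y : ℝ × ℝ} (h : IsArc c x y) :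
    ∃ γ : Path x y, Set.range γ = c := by
  obtain ⟨f, hf, rfl, h0, h1⟩ := h
  refine ⟨⟨⟨fun t => f t, ?_⟩, by simpa using h0, by simpa using h1⟩, ?_⟩
  · exact continuousOn_iff_continuous_domRestrict.1 hf
  · ext z
    constructor
    · rintro ⟨t, rfl⟩; exact ⟨t, t.2, rfl⟩
    · rintro ⟨t, ht, rfl⟩; exact ⟨⟨t, ht⟩, rfl⟩

lemma IsArc.union {A B : Set (ℝ × ℝ)} {x y z : ℝ × ℝ} (hA : IsArc A x y) (hB : IsArc B y z) :
    IsArc (A ∪ B) x z := by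
  obtain ⟨γ, rfl⟩ := hA.to_path
  obtain ⟨γ', rfl⟩ := hB.to_path
  rw [← Path.trans_range]
  exact IsArc.of_path _

lemma IsArc.segment (x y : ℝ × ℝ) : IsArc (segment ℝ x y) x y := by
  refine ⟨AffineMap.lineMap x y, ?_, segment_eq_image_lineMap ℝ x y, by simp, by simp⟩
  exact AffineMap.lineMap_continuous.continuousOn

lemma IsArc.chain (g : ℕ → ℝ × ℝ) (n : ℕ) :
    ∃ A, IsArc A (g 0) (g n) ∧ ∀ x ∈ A, x = g 0 ∨ ∃ k, 1 ≤ k ∧ k ≤ n ∧ x ∈ _root_.segment ℝ (g (k - 1)) (g k) := by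
  induction n with
  | zero => 
    refine ⟨_, IsArc.segment _ _, fun x hx => Or.inl ?_⟩
    rw [segment_same] at hx; exact hx
  | succ n ih =>
    obtain ⟨A, hA, h⟩ := ih
    refine ⟨A ∪ _root_.segment ℝ (g n) (g (n + 1)), hA.union (IsArc.segment _ _), ?_⟩
    rintro x (hx | hx)
    · rcases h x hx with h | ⟨k, h1, h2, h3⟩
      · exact Or.inl h
      · exact Or.inr ⟨k, h1, by omega, h3⟩
    · exact Or.inr ⟨n + 1, by omega, le_rfl, hx⟩

/-- combinatorial data from which a drawing is produced -/
structure RSys {V : Type} (G : SimpleGraph V) where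
  m : ℕ
  ctr : V → ℤ × ℤ
  sep : ∀ u w, u ≠ w → ¬ inBox (2 * m + 1) (ctr u) (ctr w)
  src : G.edgeSet → V
  dst : G.edgeSet → V
  hsd : ∀ e : G.edgeSet, (e : Sym2 V) = s(src e, dst e)
  M : G.edgeSet → ℕ
  hM : ∀ e, 1 ≤ M e
  y : G.edgeSet → ℕ → ℤ × ℤ
  hadj : ∀ e k, k ≤ M e → gridG.Adj (y e k) (y e (k + 1))
  h0 : ∀ e, inBox m (ctr (src e)) (y e 0)
  h1 : ∀ e, inBox m (ctr (dst e)) (y e (M e + 1))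
  hav : ∀ e k w, 1 ≤ k → k ≤ M e → ¬ inBox m (ctr w) (y e k)
  hinj : ∀ e k l, 1 ≤ k → k ≤ M e → 1 ≤ l → l ≤ M e → y e k = y e l → k = l
  hpn : ∀ e k, 1 ≤ k → k ≤ M e → y e (k - 1) ≠ y e (k + 1)
  hmid : ∀ e f, e ≠ f → ∀ i j k i' j' k', 1 ≤ i → i < j → j < k → k ≤ M e → 1 ≤ i' → i' ≤ M f →
    1 ≤ j' → j' ≤ M f → 1 ≤ k' → k' ≤ M f → y e i = y f i' → y e j = y f j' → y e k = y f k' →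
    (y e (j - 1) = y f (j' - 1) ∧ y e (j + 1) = y f (j' + 1)) ∨
    (y e (j - 1) = y f (j' + 1) ∧ y e (j + 1) = y f (j' - 1))

namespace RSys
variable {V : Type} {G : SimpleGraph V} (R : RSys G) (δ : G.edgeSet → ℝ)

/-- gates of an edge -/
noncomputable def g (e : G.edgeSet) (k : ℕ) : ℝ × ℝ := gate (R.y e k) (R.y e (k + 1)) (δ e)

/-- possible types of a point on an arc -/
def PType (e : G.edgeSet) (x : ℝ × ℝ) : Prop :=
  (∃ k ≤ R.M e, x = R.g δ e k) ∨
  (∃ k, 1 ≤ k ∧ k ≤ R.M e ∧ inCell (R.y e k) x ∧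
    onChord (R.y e (k - 1)) (R.y e k) (R.y e (k + 1)) (δ e) x) ∨
  (∃ w ∈ (e : Sym2 V), ‖x - toR (R.ctr w)‖ < R.m + 1 / 2 ∧
    ∃ k ≤ R.M e, x ∈ segment ℝ (toR (R.ctr w)) (R.g δ e k) ∧
      ‖R.g δ e k - toR (R.ctr w)‖ = R.m + 1 / 2)

variable (hd : ∀ e, 0 < δ e) (hd' : ∀ e, δ e < 1 / 4)
include hd hd'

lemma gate_far (e : G.edgeSet) (k : ℕ) (hk : k ≤ R.M e) (w : V) :
    (R.m : ℝ) + 1 / 2 ≤ ‖R.g δ e k - toR (R.ctr w)‖ := by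
  have hn := gate_near (R.hadj e k hk) (hd e) (hd' e)
  rcases Nat.eq_zero_or_pos k with rfl | hk0
  · exact far_box (R.hav e 1 w le_rfl (R.hM e)) hn.2
  · exact far_box (R.hav e k w hk0 hk) hn.1

lemma gate_eq0 (e : G.edgeSet) : ‖R.g δ e 0 - toR (R.ctr (R.src e))‖ = R.m + 1 / 2 := by
  refine le_antisymm ?_ (R.gate_far δ hd hd' e 0 (Nat.zero_le _) _)
  have hn := (gate_near (R.hadj e 0 (Nat.zero_le _)) (hd e) (hd' e)).1
  have h0 := inBox_norm (R.h0 e)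
  have := norm_add_le (R.g δ e 0 - toR (R.y e 0)) (toR (R.y e 0) - toR (R.ctr (R.src e)))
  rw [sub_add_sub_cancel] at this
  simp only [g] at this ⊢
  linarith

lemma gate_eq1 (e : G.edgeSet) : ‖R.g δ e (R.M e) - toR (R.ctr (R.dst e))‖ = R.m + 1 / 2 := by
  refine le_antisymm ?_ (R.gate_far δ hd hd' e _ le_rfl _)
  have hn := (gate_near (R.hadj e _ le_rfl) (hd e) (hd' e)).2
  have h0 := inBox_norm (R.h1 e)
  have := norm_add_le (R.g δ e (R.M e) - toR (R.y e (R.M e + 1)))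
    (toR (R.y e (R.M e + 1)) - toR (R.ctr (R.dst e)))
  rw [sub_add_sub_cancel] at this
  simp only [g] at this ⊢
  linarith

lemma arc_exists (e : G.edgeSet) : ∃ A, IsArc A (toR (R.ctr (R.src e))) (toR (R.ctr (R.dst e))) ∧
    ∀ x ∈ A, R.PType δ e x := by
  obtain ⟨A, hA, h⟩ := IsArc.chain (R.g δ e) (R.M e)
  refine ⟨_, ((IsArc.segment (toR (R.ctr (R.src e))) _).union hA).union
    (IsArc.segment _ (toR (R.ctr (R.dst e)))), ?_⟩
  have hR : (0 : ℝ) < R.m + 1 / 2 := by positivity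
  rintro x ((hx | hx) | hx)
  · rcases radial_type (R.gate_eq0 δ hd hd' e) hR hx with h | h
    · exact Or.inl ⟨0, Nat.zero_le _, h⟩
    · exact Or.inr (Or.inr ⟨R.src e, by rw [R.hsd]; simp, h, 0, Nat.zero_le _, hx,
        R.gate_eq0 δ hd hd' e⟩)
  · rcases h x hx with h | ⟨k, h1, h2, h3⟩
    · exact Or.inl ⟨0, Nat.zero_le _, h⟩
    · have a1 := R.hadj e (k - 1) (by omega)
      have a2 := R.hadj e k h2
      have a3 : k - 1 + 1 = k := by omega
      rw [a3] at a1
      simp only [g, a3] at h3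
      rcases chord_type a1.symm a2 (R.hpn e k h1 h2) (hd e) (hd' e) h3 with h | h | h
      · exact Or.inl ⟨k - 1, by omega, by simp only [g, a3, h]⟩
      · exact Or.inl ⟨k, h2, h⟩
      · exact Or.inr (Or.inl ⟨k, h1, h2, h⟩)
  · rw [segment_symm] at hx
    rcases radial_type (R.gate_eq1 δ hd hd' e) hR hx with h | h
    · exact Or.inl ⟨_, le_rfl, h⟩
    · exact Or.inr (Or.inr ⟨R.dst e, by rw [R.hsd]; simp, h, _, le_rfl, hx,
        R.gate_eq1 δ hd hd' e⟩)

omit hd hd' in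
lemma box_unique {x : ℝ × ℝ} {u w : V} (hu : ‖x - toR (R.ctr u)‖ < R.m + 1 / 2)
    (hw : ‖x - toR (R.ctr w)‖ < R.m + 1 / 2) : u = w := by
  by_contra hne
  have h := not_inBox_norm (R.sep u w hne)
  have : toR (R.ctr w) - toR (R.ctr u) = (x - toR (R.ctr u)) - (x - toR (R.ctr w)) := by abel
  rw [this] at h
  have h2 := norm_sub_le (x - toR (R.ctr u)) (x - toR (R.ctr w))
  push_cast at h
  linarith

lemma vertex_mem (e : G.edgeSet) (w : V) (h : R.PType δ e (toR (R.ctr w))) : w ∈ (e : Sym2 V) := by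
  rcases h with ⟨k, hk, h⟩ | ⟨k, h1, h2, h3, -⟩ | ⟨u, hu, h1, -⟩
  · exact absurd h.symm (gate_not_int (R.hadj e k hk) (hd e))
  · have := inCell_inj h3 (inCell_self _)
    refine absurd ?_ (R.hav e k w h1 h2)
    rw [this]
    refine ⟨?_, ?_, ?_, ?_⟩ <;> omega
  · have : u = w := R.box_unique h1 (by simp; positivity)
    rwa [← this]

/-- crossing points inside cells -/
def Tset (e f : G.edgeSet) : Set (ℝ × ℝ) :=
  {x | ∃ k l, 1 ≤ k ∧ k ≤ R.M e ∧ 1 ≤ l ∧ l ≤ R.M f ∧ R.y e k = R.y f l ∧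
    onChord (R.y e (k - 1)) (R.y e k) (R.y e (k + 1)) (δ e) x ∧
    onChord (R.y f (l - 1)) (R.y f l) (R.y f (l + 1)) (δ f) x}

lemma common (e f : G.edgeSet) (hef : δ e ≠ δ f) (x : ℝ × ℝ)
    (he : R.PType δ e x) (hf : R.PType δ f x) :
    x ∈ R.Tset δ e f ∨ ∃ w, toR (R.ctr w) = x ∧ w ∈ (e : Sym2 V) ∧ w ∈ (f : Sym2 V) := by
  have cellfar : ∀ e k w, 1 ≤ k → k ≤ R.M e → inCell (R.y e k) x →
      (R.m : ℝ) + 1 / 2 ≤ ‖x - toR (R.ctr w)‖ := fun e k w h1 h2 h3 =>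
    far_box (R.hav e k w h1 h2) (inCell_near h3)
  rcases he with ⟨k, hk, h⟩ | ⟨k, h1, h2, h3, h4⟩ | ⟨u, hu, h1, k, h2, h3, h4⟩
  · rcases hf with ⟨l, hl, h'⟩ | ⟨l, h1', h2', h3', h4'⟩ | ⟨u', hu', h1', l, h2', h3', h4'⟩
    · exact absurd (h.symm.trans h') (gate_ne (R.hadj e k hk) (R.hadj f l hl) (hd e) (hd' e) (hd f)
        (hd' f) hef)
    · exact absurd (h ▸ h3') (gate_not_inCell (R.hadj e k hk) (hd e))
    · have := R.gate_far δ hd hd' e k hk u'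
      rw [← h] at this; linarith
  · rcases hf with ⟨l, hl, h'⟩ | ⟨l, h1', h2', h3', h4'⟩ | ⟨u', hu', h1', l, h2', h3', h4'⟩
    · exact absurd (h' ▸ h3) (gate_not_inCell (R.hadj f l hl) (hd f))
    · exact Or.inl ⟨k, l, h1, h2, h1', h2', inCell_inj h3 h3', h4, h4'⟩
    · have := cellfar e k u' h1 h2 h3
      linarith
  · rcases hf with ⟨l, hl, h'⟩ | ⟨l, h1', h2', h3', h4'⟩ | ⟨u', hu', h1', l, h2', h3', h4'⟩
    · have := R.gate_far δ hd hd' f l hl u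
      rw [← h'] at this; linarith
    · have := cellfar f l u h1' h2' h3'
      linarith
    · obtain rfl := R.box_unique h1 h1'
      refine Or.inr ⟨u, ?_, hu, hu'⟩
      exact (radial_radial h4 h4' (by positivity) (gate_ne (R.hadj e k h2) (R.hadj f l h2') (hd e)
        (hd' e) (hd f) (hd' f) hef) h3 h3').symm

lemma Tset_two (e f : G.edgeSet) (hne : e ≠ f) (hef : δ e ≠ δ f) :
    ∃ p q, R.Tset δ e f ⊆ {p, q} := by
  have key : ∀ x1 x2 x3, x1 ∈ R.Tset δ e f → x2 ∈ R.Tset δ e f → x3 ∈ R.Tset δ e f →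
      x1 = x2 ∨ x2 = x3 ∨ x1 = x3 := by
    have adj1 : ∀ e k, 1 ≤ k → k ≤ R.M e → gridG.Adj (R.y e k) (R.y e (k - 1)) := by
      intro e k h1 h2
      have := R.hadj e (k - 1) (by omega)
      rw [show k - 1 + 1 = k by omega] at this
      exact this.symm
    have one : ∀ x1 x2 k l l', 1 ≤ k → k ≤ R.M e → 1 ≤ l → l ≤ R.M f → 1 ≤ l' → l' ≤ R.M f →
        R.y e k = R.y f l → R.y e k = R.y f l' → 
        onChord (R.y e (k - 1)) (R.y e k) (R.y e (k + 1)) (δ e) x1 →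
        onChord (R.y f (l - 1)) (R.y f l) (R.y f (l + 1)) (δ f) x1 → 
        onChord (R.y e (k - 1)) (R.y e k) (R.y e (k + 1)) (δ e) x2 →
        onChord (R.y f (l' - 1)) (R.y f l') (R.y f (l' + 1)) (δ f) x2 → x1 = x2 := by
      intro x1 x2 k l l' h1 h2 h3 h4 h5 h6 e1 e2 o1 o2 o3 o4
      obtain rfl := R.hinj f l l' h3 h4 h5 h6 (e1.symm.trans e2)
      have a1 := adj1 f l h3 h4
      have a2 := R.hadj f l h4
      rw [← e1] at a1 a2 o2 o4
      exact chord_chord (adj1 e k h1 h2) (R.hadj e k h2) (R.hpn e k h1 h2) a1 a2 (R.hpn f l h3 h4)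
        (hd e) (hd' e) (hd f) (hd' f) hef o1 o3 o2 o4
    have mid : ∀ i j k i' j' k' x, 1 ≤ i → i < j → j < k → k ≤ R.M e → 1 ≤ i' → i' ≤ R.M f →
      1 ≤ j' → j' ≤ R.M f → 1 ≤ k' → k' ≤ R.M f → R.y e i = R.y f i' → R.y e j = R.y f j' →
      R.y e k = R.y f k' →
      onChord (R.y e (j - 1)) (R.y e j) (R.y e (j + 1)) (δ e) x →
      onChord (R.y f (j' - 1)) (R.y f j') (R.y f (j' + 1)) (δ f) x → False := by
      intro i j k i' j' k' x h1 h2 h3 h4 h5 h6 h7 h8 h9 h10 e1 e2 e3 o1 o2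
      have := R.hmid e f hne i j k i' j' k' h1 h2 h3 h4 h5 h6 h7 h8 h9 h10 e1 e2 e3
      rw [← e2] at o2
      exact chord_good (adj1 e j (by omega) (by omega)) (R.hadj e j (by omega))
        (R.hpn e j (by omega) (by omega)) this (hd e) (hd f) hef o1 o2
    rintro x1 x2 x3 ⟨k1, l1, a1, a2, a3, a4, a5, a6, a7⟩ ⟨k2, l2, b1, b2, b3, b4, b5, b6, b7⟩
      ⟨k3, l3, c1, c2, c3, c4, c5, c6, c7⟩
    by_cases h12 : k1 = k2
    · subst h12; exact Or.inl (one _ _ _ _ _ a1 a2 a3 a4 b3 b4 a5 b5 a6 a7 b6 b7)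
    by_cases h23 : k2 = k3
    · subst h23; exact Or.inr (Or.inl (one _ _ _ _ _ b1 b2 b3 b4 c3 c4 b5 c5 b6 b7 c6 c7))
    by_cases h13 : k1 = k3
    · subst h13; exact Or.inr (Or.inr (one _ _ _ _ _ a1 a2 a3 a4 c3 c4 a5 c5 a6 a7 c6 c7))
    exfalso
    rcases lt_or_gt_of_ne h12 with u | u <;> rcases lt_or_gt_of_ne h23 with v | v <;>
      rcases lt_or_gt_of_ne h13 with w | w
    · exact mid k1 k2 k3 l1 l2 l3 x2 a1 u v c2 a3 a4 b3 b4 c3 c4 a5 b5 c5 b6 b7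
    · omega
    · exact mid k1 k3 k2 l1 l3 l2 x3 a1 w v b2 a3 a4 c3 c4 b3 b4 a5 c5 b5 c6 c7
    · exact mid k3 k1 k2 l3 l1 l2 x1 c1 w u b2 c3 c4 a3 a4 b3 b4 c5 a5 b5 a6 a7
    · exact mid k2 k1 k3 l2 l1 l3 x1 b1 u w c2 b3 b4 a3 a4 c3 c4 b5 a5 c5 a6 a7
    · exact mid k2 k3 k1 l2 l3 l1 x3 b1 v w a2 b3 b4 c3 c4 a3 a4 b5 c5 a5 c6 c7
    · omega
    · exact mid k3 k2 k1 l3 l2 l1 x2 c1 v u a2 c3 c4 b3 b4 a3 a4 c5 b5 a5 b6 b7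
  by_cases h : ∃ p q, p ∈ R.Tset δ e f ∧ q ∈ R.Tset δ e f ∧ p ≠ q
  · obtain ⟨p, q, hp, hq, hpq⟩ := h
    refine ⟨p, q, fun x hx => ?_⟩
    rcases key p q x hp hq hx with h | h | h
    · exact absurd h hpq
    · exact Or.inr h.symm
    · exact Or.inl h.symm
  · push Not at h
    rcases (R.Tset δ e f).eq_empty_or_nonempty with h0 | ⟨p, hp⟩
    · exact ⟨0, 0, by rw [h0]; exact Set.empty_subset _⟩
    · exact ⟨p, p, fun x hx => Or.inl (h x p hx hp)⟩

omit hd hd' in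
theorem realize [Finite V] : ∃ D : G.Drawing, ∀ e f, e ≠ f → (D.crossSet e f).ncard ≤ 2 ∧
    ((D.crossSet e f).Nonempty → ∃ k l, 1 ≤ k ∧ k ≤ R.M e ∧ 1 ≤ l ∧ l ≤ R.M f ∧
      R.y e k = R.y f l) := by
  have : Finite G.edgeSet := inferInstance
  obtain ⟨n, ⟨i⟩⟩ := Finite.exists_equiv_fin G.edgeSet
  let δ : G.edgeSet → ℝ := fun e => 1 / ((i e : ℕ) + 5)
  have hd : ∀ e, 0 < δ e := fun e => by positivity
  have hd' : ∀ e, δ e < 1 / 4 := fun e => by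
    simp only [δ]
    apply one_div_lt_one_div_of_lt (by norm_num)
    have : (0 : ℝ) ≤ (i e : ℕ) := by positivity
    linarith
  have hδ : ∀ e f, e ≠ f → δ e ≠ δ f := by
    intro e f hef h
    simp only [δ, one_div, inv_inj, add_left_inj, Nat.cast_inj] at h
    exact hef (i.injective (Fin.ext h))
  choose A hA hP using R.arc_exists δ hd hd'
  have hsub : ∀ e f, e ≠ f → A e ∩ A f ⊆ R.Tset δ e f ∪
      {x | ∃ w, toR (R.ctr w) = x ∧ w ∈ (e : Sym2 V) ∧ w ∈ (f : Sym2 V)} := by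
    rintro e f hef x ⟨h1, h2⟩
    exact R.common δ hd hd' e f (hδ e f hef) x (hP e x h1) (hP f x h2)
  obtain ⟨D, hpt, harc⟩ : ∃ D : G.Drawing, D.pt = (fun w => toR (R.ctr w)) ∧ D.arc = A := by
    refine ⟨⟨fun w => toR (R.ctr w), ?_, A, fun e => ⟨R.src e, R.dst e, R.hsd e, hA e⟩,
      fun e w hw => R.vertex_mem δ hd hd' e w (hP e _ hw), ?_⟩, rfl, rfl⟩
    · intro u w h
      refine R.box_unique (x := toR (R.ctr u)) (by simp; positivity) ?_
      simp only at h
      rw [h]; simp; positivity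
    · intro e f hef
      obtain ⟨p, q, hpq⟩ := R.Tset_two δ hd hd' e f hef (hδ e f hef)
      refine Set.Finite.subset ?_ (hsub e f hef)
      refine ((Set.toFinite {p, q}).subset hpq).union ?_
      refine (Set.finite_range (fun w => toR (R.ctr w))).subset ?_
      rintro x ⟨w, hw, -⟩
      exact ⟨w, hw⟩
  refine ⟨D, ?_⟩
  intro e f hef
  have hs : D.crossSet e f ⊆ R.Tset δ e f := by
    rintro x ⟨h1, h2⟩
    rw [harc] at h1
    rw [hpt] at h2
    exact (hsub e f hef h1).resolve_right h2
  constructor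
  · obtain ⟨p, q, hpq⟩ := R.Tset_two δ hd hd' e f hef (hδ e f hef)
    exact (Set.ncard_le_ncard (hs.trans hpq) (Set.toFinite _)).trans (Set.ncard_insert_le p {q} |>.trans (by simp))
  · rintro ⟨x, hx⟩
    obtain ⟨k, l, h1, h2, h3, h4, h5, -⟩ := hs hx
    exact ⟨k, l, h1, h2, h3, h4, h5⟩
end RSys


/-- a discretized drawing -/
structure GSys {V : Type} (G : SimpleGraph V) where
  m : ℕ
  ctr : V → ℤ × ℤ
  sep : ∀ u w, u ≠ w → ¬ inBox (2 * m + 1) (ctr u) (ctr w)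
  src : G.edgeSet → V
  dst : G.edgeSet → V
  hsd : ∀ e : G.edgeSet, (e : Sym2 V) = s(src e, dst e)
  z0 : G.edgeSet → ℤ × ℤ
  z1 : G.edgeSet → ℤ × ℤ
  a : G.edgeSet → ℤ × ℤ
  b : G.edgeSet → ℤ × ℤ
  h0 : ∀ e, inBox m (ctr (src e)) (z0 e)
  h1 : ∀ e, inBox m (ctr (dst e)) (z1 e)
  adj0 : ∀ e, gridG.Adj (z0 e) (a e)
  adj1 : ∀ e, gridG.Adj (b e) (z1 e)
  Z : ∀ e, gridG.Walk (a e) (b e)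
  avoid : ∀ e w, ∀ x ∈ (Z e).support, ¬ inBox m (ctr w) x

namespace GSys
variable {V : Type} {G : SimpleGraph V} (S : GSys G)

/-- extended path -/
def yy {F : SimpleGraph (ℤ × ℤ)} (p : ∀ e, F.Path (S.a e) (S.b e)) (e : G.edgeSet) (k : ℕ) : ℤ × ℤ :=
  if k = 0 then S.z0 e else if k ≤ (p e).1.length + 1 then (p e).1.getVert (k - 1) else S.z1 e

lemma yy_mid {F : SimpleGraph (ℤ × ℤ)} (p : ∀ e, F.Path (S.a e) (S.b e)) (e : G.edgeSet) {k : ℕ}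
    (h1 : 1 ≤ k) (h2 : k ≤ (p e).1.length + 1) : S.yy p e k = (p e).1.getVert (k - 1) := by
  rw [yy, if_neg (by omega), if_pos h2]

lemma yy_zero {F : SimpleGraph (ℤ × ℤ)} (p : ∀ e, F.Path (S.a e) (S.b e)) (e : G.edgeSet) :
    S.yy p e 0 = S.z0 e := by
  rw [yy, if_pos rfl]

lemma yy_last {F : SimpleGraph (ℤ × ℤ)} (p : ∀ e, F.Path (S.a e) (S.b e)) (e : G.edgeSet) :
    S.yy p e ((p e).1.length + 2) = S.z1 e := by
  rw [yy, if_neg (by omega), if_neg (by omega)]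

/-- the realizable system -/
def toR {F : SimpleGraph (ℤ × ℤ)} (hF : F.IsAcyclic) (p : ∀ e, F.Path (S.a e) (S.b e))
    (hFg : ∀ x y, F.Adj x y → gridG.Adj x y)
    (hp : ∀ e, ∀ x ∈ (p e).1.support, ∀ w, ¬ inBox S.m (S.ctr w) x) : RSys G where
  m := S.m
  ctr := S.ctr
  sep := S.sep
  src := S.src
  dst := S.dst
  hsd := S.hsd
  M e := (p e).1.length + 1
  hM e := by omega
  y := S.yy p
  hadj := by
    intro e k hk
    rcases Nat.eq_zero_or_pos k with rfl | h
    · rw [yy_zero, S.yy_mid p e le_rfl (by omega)]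
      simpa using S.adj0 e
    · rw [S.yy_mid p e h hk]
      rcases hk.eq_or_lt with rfl | hk
      · rw [S.yy_last]
        simpa using S.adj1 e
      · rw [S.yy_mid p e (by omega) (by omega)]
        have := (p e).1.adj_getVert_succ (i := k - 1) (by omega)
        rw [show k - 1 + 1 = k + 1 - 1 by omega] at this
        exact hFg _ _ this
  h0 e := by rw [yy_zero]; exact S.h0 e
  h1 e := by rw [yy_last]; exact S.h1 e
  hav := by
    intro e k w h1 h2
    rw [S.yy_mid p e h1 h2]
    exact hp e _ ((p e).1.getVert_mem_support _) w
  hinj := by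
    intro e k l h1 h2 h3 h4 h
    rw [S.yy_mid p e h1 h2, S.yy_mid p e h3 h4] at h
    have := (p e).2.getVert_injOn (by simp; omega) (by simp; omega) h
    omega
  hpn := by
    intro e k h1 h2 h
    by_cases hk : k = 1
    · subst hk
      rw [show 1 - 1 = 0 from rfl, yy_zero] at h
      by_cases hl : (p e).1.length = 0
      · have := S.yy_last p e
        rw [hl] at this
        rw [this] at h
        have g0 := inBox_norm (S.h0 e)
        have g1 := inBox_norm (S.h1 e)
        rw [← h] at g1
        have hne : S.src e ≠ S.dst e := by
          have := e.2
          rw [S.hsd e, SimpleGraph.mem_edgeSet] at this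
          exact this.ne
        have g2 := not_inBox_norm (S.sep _ _ hne)
        have g3 := norm_sub_le (_root_.toR (S.z0 e) - _root_.toR (S.ctr (S.src e)))
          (_root_.toR (S.z0 e) - _root_.toR (S.ctr (S.dst e)))
        rw [sub_sub_sub_cancel_left] at g3
        push_cast at g2
        linarith
      · rw [S.yy_mid p e (by omega) (by omega)] at h
        exact hp e _ ((p e).1.getVert_mem_support _) _ (h ▸ S.h0 e)
    · rw [S.yy_mid p e (by omega) (by omega)] at h
      rcases h2.eq_or_lt with rfl | h2
      · rw [S.yy_last] at h
        exact hp e _ ((p e).1.getVert_mem_support _) _ (h ▸ S.h1 e)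
      · rw [S.yy_mid p e (by omega) (by omega)] at h
        have := (p e).2.getVert_injOn (by simp; omega) (by simp; omega) h
        omega
  hmid := by
    intro e f hef i j k i' j' k' h1 h2 h3 h4 h5 h6 h7 h8 h9 h10 e1 e2 e3
    rw [S.yy_mid p e (by omega) (by omega), S.yy_mid p f (by omega) (by omega)] at e1 e2 e3
    obtain ⟨g1, g2, g3⟩ := middle_good hF (p e).2 (p f).2 (i := i - 1) (j := j - 1) (k := k - 1)
      (i' := i' - 1) (j' := j' - 1) (k' := k' - 1) (by omega) (by omega) (by omega) (by omega)
      (by omega) (by omega) e1 e2 e3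
    rw [S.yy_mid p e (k := j - 1) (by omega) (by omega),
      S.yy_mid p e (k := j + 1) (by omega) (by omega),
      S.yy_mid p f (k := j' - 1) (by omega) (by omega),
      S.yy_mid p f (k := j' + 1) (by omega) (by omega)]
    rw [show j - 1 + 1 = j + 1 - 1 by omega, show j' - 1 + 1 = j' + 1 - 1 by omega] at g3
    exact g3

open Classical in
theorem cr_le [Fintype V] (c : ℕ) (h : Elim (touch S.Z) univ c) : G.cr ≤ 2 * c := by
  obtain ⟨F, -, hF, hFa, T, hT, hc⟩ := forest_exists S.Z univ c h ⊥ SimpleGraph.isAcyclic_bot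
    (fun x y h => absurd h (by simp))
  choose p hp1 hp2 using fun e => hT e (mem_univ e)
  let R := S.toR hF p (fun x y hxy => by
    rcases hFa x y hxy with h | h
    · exact absurd h (by simp)
    · exact h.1) (fun e x hx w => by
    have : x ∈ T e := by rw [hp1]; exact hx
    obtain ⟨f, -, hf⟩ := hp2 e this
    exact S.avoid f w x hf)
  obtain ⟨D, hD⟩ := R.realize
  have hnon : ∀ e f, e ≠ f → (D.crossSet e f).Nonempty → (T e ∩ T f).Nonempty := by
    intro e f hef hne
    obtain ⟨k, l, h1, h2, h3, h4, h5⟩ := (hD e f hef).2 hne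
    have h5 : S.yy p e k = S.yy p f l := h5
    rw [S.yy_mid p e h1 h2, S.yy_mid p f h3 h4] at h5
    refine ⟨(p e).1.getVert (k - 1), ?_, ?_⟩
    · rw [hp1]; exact (p e).1.getVert_mem_support _
    · rw [hp1, h5]; exact (p f).1.getVert_mem_support _
  have hcc : D.crossingCount ≤ 2 * c := by
    have : (∑ᶠ (e : G.edgeSet) (e' : G.edgeSet) (_ : e ≠ e'), (D.crossSet e e').ncard) ≤ 2 * (2 * c) := by
      rw [finsum_eq_sum_of_fintype]
      simp only [finsum_eq_sum_of_fintype, finsum_eq_if]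
      rw [← Finset.sum_product']
      refine le_trans (Finset.sum_le_sum (g := fun q : G.edgeSet × G.edgeSet =>
        if q.1 ≠ q.2 ∧ (T q.1 ∩ T q.2).Nonempty then 2 else 0) ?_) ?_
      · rintro ⟨e, f⟩ -
        by_cases hef : e ≠ f
        · rw [if_pos hef]
          by_cases hn : (D.crossSet e f).Nonempty
          · rw [if_pos ⟨hef, hnon e f hef hn⟩]
            exact (hD e f hef).1
          · rw [Set.not_nonempty_iff_eq_empty] at hn
            rw [hn]; simp
        · rw [if_neg hef]; exact Nat.zero_le _
      · rw [← Finset.sum_filter, Finset.sum_const, smul_eq_mul, mul_comm]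
        exact Nat.mul_le_mul_left 2 hc
    rw [SimpleGraph.Drawing.crossingCount]
    omega
  exact (Nat.sInf_le ⟨D, rfl⟩ : G.cr ≤ _).trans hcc
end GSys


lemma elim_iso {E : Type*} [DecidableEq E] {τ : E → E → Prop} {X : Finset E} {c : ℕ}
    (h : Elim τ X c) (Y : Finset E) (hd : ∀ s ∈ Y, s ∉ X) (hY : ∀ s ∈ Y, ∀ f, s ≠ f → ¬ τ s f) :
    Elim τ (X ∪ Y) c := by
  induction Y using Finset.induction_on with
  | empty => simpa using h
  | insert s Y hs ih =>
    have h1 := ih (fun t ht => hd t (by simp [ht])) (fun t ht => hY t (by simp [ht]))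
    have h2 : Elim τ {s} 0 := by
      have := Elim.add (τ := τ) ∅ s 0 (by simp) Elim.empty
      simpa using this
    have hsX : s ∉ X ∪ Y := by
      simp only [mem_union, not_or]; exact ⟨hd s (by simp), hs⟩
    have h3 := Elim.union _ _ _ _ (by simpa using hsX) (fun e he f hf => by
      rw [mem_singleton] at he
      subst he
      exact hY e (by simp) f (by rintro rfl; exact hsX hf)) h2 h1
    rw [zero_add] at h3
    convert h3 using 1
    ext t; simp

lemma arith_final {p : ℕ} (hp : 2 ≤ p) {c : ℕ} {n k : ℕ} {κ K : ℝ} (hn : n ≤ 2 * p + 1)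
    (hκ : κ = 1 + √(120 * (4 * p + 2))) (hk : k = Nat.log 2 p + 3)
    (hK : K = 16 * κ * (k + 2) / Real.log 2) (hc : (c : ℝ) ≤ K * n * Real.log n) :
    2 * (c : ℝ) ≤ 200000 * (p : ℝ) ^ ((3 : ℝ) / 2) * (Real.log p) ^ 2 := by
  have hp' : (2 : ℝ) ≤ p := by exact_mod_cast hp
  have l2 : 1 / 2 < Real.log 2 := by have := Real.log_two_gt_d9; linarith
  have hlp : Real.log 2 ≤ Real.log p := Real.log_le_log (by norm_num) hp'
  have hs1 : 1 ≤ √(p : ℝ) := by rw [Real.one_le_sqrt]; linarith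
  have hκ' : κ ≤ 26 * √p := by
    have : √(120 * (4 * (p : ℝ) + 2)) ≤ 25 * √p := by
      rw [Real.sqrt_le_left (by positivity), mul_pow, Real.sq_sqrt (by positivity)]
      linarith
    linarith
  have hκ0 : 0 ≤ κ := by rw [hκ]; positivity
  have hkk : (k : ℝ) + 2 ≤ 12 * Real.log p := by
    have h1 : ((Nat.log 2 p : ℕ) : ℝ) * Real.log 2 ≤ Real.log p := by
      rw [← Real.log_pow]
      apply Real.log_le_log (by positivity)
      exact_mod_cast Nat.pow_log_le_self 2 (by omega)
    have h2 : ((Nat.log 2 p : ℕ) : ℝ) * (1 / 2) ≤ (Nat.log 2 p : ℕ) * Real.log 2 := by gcongr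
    rw [hk]; push_cast
    linarith
  have hlp0 : 0 < Real.log p := by linarith
  have hK' : K ≤ 9984 * √p * Real.log p := by
    rw [hK, div_le_iff₀ (by linarith)]
    calc 16 * κ * (k + 2) ≤ 16 * (26 * √p) * (12 * Real.log p) := by gcongr
      _ = 9984 * √p * Real.log p * (1 / 2) := by ring
      _ ≤ _ := by gcongr
  have hK0 : 0 ≤ K := by rw [hK]; positivity
  have hn' : (n : ℝ) ≤ 3 * p := by
    have : (n : ℝ) ≤ 2 * p + 1 := by exact_mod_cast hn
    linarith
  have hln : Real.log n ≤ 3 * Real.log p := by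
    rcases Nat.eq_zero_or_pos n with rfl | h0
    · simp; linarith
    · have : 3 * Real.log p = Real.log ((p : ℝ) ^ 3) := by rw [Real.log_pow]; norm_num
      rw [this]
      apply Real.log_le_log (by exact_mod_cast h0)
      have : (p : ℝ) ^ 3 ≥ 4 * p := by
        have : (4 : ℝ) ≤ p ^ 2 := by nlinarith
        have h7 : (p : ℝ) ^ 3 = (p : ℝ) ^ 2 * (p : ℝ) := by ring
        have h8 : 4 * (p : ℝ) ≤ (p : ℝ) ^ 2 * (p : ℝ) := by gcongr
        linarith
      linarith
  have hln0 : 0 ≤ Real.log n := Real.log_natCast_nonneg n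
  have hpow : (p : ℝ) ^ ((3 : ℝ) / 2) = p * √p := by
    rw [show (3 : ℝ) / 2 = 1 + 1 / 2 by norm_num, Real.rpow_add (by linarith), Real.rpow_one,
      Real.sqrt_eq_rpow]
  have : (c : ℝ) ≤ (9984 * √p * Real.log p) * (3 * p) * (3 * Real.log p) := hc.trans (by gcongr)
  rw [hpow]
  have h5 : 0 ≤ p * √p * Real.log p ^ 2 := by positivity
  nlinarith

open Classical in
theorem assemble {V : Type} [Fintype V] {G : SimpleGraph V} (S : GSys G) (D : G.Drawing)
    (hS : ∀ e f, e ≠ f → touch S.Z e f → (D.crossSet e f).Nonempty) {p : ℕ} (hp : 2 ≤ p)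
    (hD : D.crossingPairCount = p) :
    (G.cr : ℝ) ≤ 200000 * (p : ℝ) ^ ((3 : ℝ) / 2) * (Real.log p) ^ 2 := by
  let τ := touch S.Z
  let P : Finset (G.edgeSet × G.edgeSet) := {q | q.1 ≠ q.2 ∧ τ q.1 q.2}
  have hP : #P ≤ 2 * p + 1 := by
    have h1 : #P ≤ Nat.card {q : G.edgeSet × G.edgeSet // q.1 ≠ q.2 ∧ (D.crossSet q.1 q.2).Nonempty} := by
      rw [Nat.card_eq_fintype_card, Fintype.card_subtype]
      apply card_le_card
      intro q hq
      simp only [P, mem_filter, mem_univ, true_and] at hq ⊢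
      exact ⟨hq.1, hS _ _ hq.1 hq.2⟩
    rw [SimpleGraph.Drawing.crossingPairCount] at hD
    omega
  let X0 := P.image Prod.fst
  have hX0 : #X0 ≤ 2 * p + 1 := card_image_le.trans hP
  have hdeg : ∑ u ∈ X0, tdeg τ X0 u ≤ 4 * p + 2 := by
    simp only [tdeg]
    rw [← Finset.sum_product', Finset.sum_boole]
    have : #{q ∈ X0 ×ˢ X0 | τ q.1 q.2} ≤ #P + #X0 := by
      refine le_trans (card_le_card (t := P ∪ X0.image (fun x => (x, x))) ?_)
        ((card_union_le _ _).trans (Nat.add_le_add_left card_image_le _))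
      rintro ⟨x, y⟩ hq
      simp only [mem_filter, mem_product] at hq
      rw [mem_union]
      by_cases hxy : x = y
      · right; rw [mem_image]; exact ⟨x, hq.1.1, by rw [hxy]⟩
      · left; simp only [P, mem_filter, mem_univ, true_and]; exact ⟨hxy, hq.2⟩
    have : #{q ∈ X0 ×ˢ X0 | τ q.1 q.2} ≤ 4 * p + 2 := by omega
    exact_mod_cast this
  have hpk : 2 * p + 1 ≤ 2 ^ (Nat.log 2 p + 3) := by
    have := Nat.lt_pow_succ_log_self (b := 2) (by norm_num) p
    have e : 2 ^ (Nat.log 2 p + 3) = 4 * 2 ^ (Nat.log 2 p).succ := by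
      rw [Nat.succ_eq_add_one]; ring
    omega
  obtain ⟨c, hc, hcb⟩ := elim_bound (τ := τ) (touch_symm S.Z) (K5Prop_touch S.Z) X0
    (1 + √(120 * (4 * p + 2))) (by have := Real.sqrt_nonneg (120 * (4 * (p : ℝ) + 2)); linarith)
    (by rw [add_sub_cancel_left, Real.sq_sqrt (by positivity)]; gcongr)
    (Nat.log 2 p + 3) (hX0.trans hpk)
    (16 * (1 + √(120 * (4 * p + 2))) * ((Nat.log 2 p + 3 : ℕ) + 2) / Real.log 2)
    (by rw [div_mul_cancel₀ _ (Real.log_pos (by norm_num)).ne']) _ X0 subset_rfl le_rfl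
  have hE : Elim τ univ c := by
    have := elim_iso hc (univ \ X0) (fun s hs => (mem_sdiff.1 hs).2) (fun s hs f hsf ht => by
      refine (mem_sdiff.1 hs).2 (mem_image.2 ⟨(s, f), ?_, rfl⟩)
      simp only [P, mem_filter, mem_univ, true_and]
      exact ⟨hsf, ht⟩)
    rwa [union_sdiff_of_subset (subset_univ _)] at this
  have h1 : (G.cr : ℝ) ≤ 2 * c := by exact_mod_cast S.cr_le c hE
  exact h1.trans (arith_final hp hX0 rfl rfl rfl hcb)


lemma last_exit (A : Set (ℤ × ℤ)) {x y : ℤ × ℤ} (W : gridG.Walk x y) (hy : y ∉ A) :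
    (∀ z ∈ W.support, z ∉ A) ∨ ∃ z0 a, z0 ∈ A ∧ z0 ∈ W.support ∧ gridG.Adj z0 a ∧
      ∃ W' : gridG.Walk a y, ∀ z ∈ W'.support, z ∈ W.support ∧ z ∉ A := by
  induction W with
  | nil => left; simpa using hy
  | @cons x v y h p ih =>
    rcases ih hy with h1 | ⟨z0, a, h1, h2, h3, W', h4⟩
    · by_cases hx : x ∈ A
      · exact Or.inr ⟨x, v, hx, by simp, h, p, fun z hz => ⟨by simp [hz], h1 z hz⟩⟩
      · left
        intro z hz
        rw [SimpleGraph.Walk.support_cons, List.mem_cons] at hz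
        rcases hz with rfl | hz
        · exact hx
        · exact h1 z hz
    · exact Or.inr ⟨z0, a, h1, by simp [h2], h3, W', fun z hz => ⟨by simp [(h4 z hz).1], (h4 z hz).2⟩⟩

lemma cut_walk (A B : Set (ℤ × ℤ)) {x y : ℤ × ℤ} (W : gridG.Walk x y) (hx : x ∈ A) (hy : y ∈ B)
    (hAB : ∀ z ∈ A, z ∉ B) (hadj : ∀ z ∈ A, ∀ w ∈ B, ¬ gridG.Adj z w) :
    ∃ z0 a b z1, z0 ∈ A ∧ z1 ∈ B ∧ gridG.Adj z0 a ∧ gridG.Adj b z1 ∧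
      ∃ Z : gridG.Walk a b, ∀ z ∈ Z.support, z ∈ W.support ∧ z ∉ A ∧ z ∉ B := by
  rcases last_exit A W (fun h => hAB y h hy) with h | ⟨z0, a, h1, -, h3, W', h4⟩
  · exact absurd hx (h x W.start_mem_support)
  · rcases last_exit B W'.reverse (fun h => hadj z0 h1 a h h3) with h | ⟨z1, b, g1, -, g3, Z, g4⟩
    · exact absurd hy (h y W'.reverse.start_mem_support)
    · refine ⟨z0, a, b, z1, h1, g1, h3, g3.symm, Z.reverse, fun z hz => ?_⟩
      rw [SimpleGraph.Walk.support_reverse, List.mem_reverse] at hz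
      have := g4 z hz
      rw [SimpleGraph.Walk.support_reverse, List.mem_reverse] at this
      exact ⟨(h4 z this.1).1, (h4 z this.1).2, this.2⟩

lemma step_walk (q r : ℤ × ℤ) (h1 : |q.1 - r.1| ≤ 1) (h2 : |q.2 - r.2| ≤ 1) :
    ∃ W : gridG.Walk q r, ∀ z ∈ W.support, |z.1 - q.1| ≤ 1 ∧ |z.2 - q.2| ≤ 1 := by
  have key : ∀ s t : ℤ × ℤ, (s = t ∨ gridG.Adj s t) →
      ∃ W : gridG.Walk s t, ∀ z ∈ W.support, z = s ∨ z = t := by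
    rintro s t (rfl | h)
    · exact ⟨SimpleGraph.Walk.nil, by simp⟩
    · exact ⟨h.toWalk, by simp⟩
  obtain ⟨a, b⟩ := q
  obtain ⟨c, d⟩ := r
  simp only [abs_le] at h1 h2 ⊢
  have k1 : a = c ∨ a = c + 1 ∨ c = a + 1 := by omega
  have k2 : b = d ∨ b = d + 1 ∨ d = b + 1 := by omega
  obtain ⟨W1, hW1⟩ := key (a, b) (c, b) (by
    rcases k1 with k1 | k1
    · left; rw [k1]
    · right; right; exact ⟨rfl, k1⟩)
  obtain ⟨W2, hW2⟩ := key (c, b) (c, d) (by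
    rcases k2 with k2 | k2
    · left; rw [k2]
    · right; left; exact ⟨rfl, k2⟩)
  refine ⟨W1.append W2, fun z hz => ?_⟩
  rw [SimpleGraph.Walk.mem_support_append_iff] at hz
  rcases hz with hz | hz
  · rcases hW1 z hz with rfl | rfl <;> simp only <;> omega
  · rcases hW2 z hz with rfl | rfl <;> simp only <;> omega

lemma seq_walk (q : ℕ → ℤ × ℤ) (N : ℕ) (h : ∀ i < N, |(q i).1 - (q (i + 1)).1| ≤ 1 ∧
    |(q i).2 - (q (i + 1)).2| ≤ 1) :
    ∃ W : gridG.Walk (q 0) (q N), ∀ z ∈ W.support, ∃ i ≤ N, |z.1 - (q i).1| ≤ 1 ∧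
      |z.2 - (q i).2| ≤ 1 := by
  induction N with
  | zero => exact ⟨SimpleGraph.Walk.nil, by simp⟩
  | succ N ih =>
    obtain ⟨W, hW⟩ := ih (fun i hi => h i (by omega))
    obtain ⟨W', hW'⟩ := step_walk _ _ (h N (by omega)).1 (h N (by omega)).2
    refine ⟨W.append W', fun z hz => ?_⟩
    rw [SimpleGraph.Walk.mem_support_append_iff] at hz
    rcases hz with hz | hz
    · obtain ⟨i, hi, h1⟩ := hW z hz
      exact ⟨i, by omega, h1⟩
    · exact ⟨N, by omega, hW' z hz⟩

/-- the cell of a point -/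
noncomputable def fl (h : ℝ) (x : ℝ × ℝ) : ℤ × ℤ := (⌊x.1 / h⌋, ⌊x.2 / h⌋)

lemma floor_near {h x : ℝ} (hh : 0 < h) : h * ⌊x / h⌋ ≤ x ∧ x < h * ⌊x / h⌋ + h := by
  have h1 := Int.floor_le (x / h)
  have h2 := Int.lt_floor_add_one (x / h)
  rw [le_div_iff₀ hh] at h1
  rw [div_lt_iff₀ hh] at h2
  constructor <;> linarith

lemma floor_step {h x y : ℝ} (hh : 0 < h) (hxy : |x - y| < h) : |⌊x / h⌋ - ⌊y / h⌋| ≤ 1 := by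
  obtain ⟨a1, a2⟩ := floor_near (x := x) hh
  obtain ⟨b1, b2⟩ := floor_near (x := y) hh
  obtain ⟨c1, c2⟩ := abs_lt.1 hxy
  have d1 : h * ((⌊x / h⌋ : ℝ) - ⌊y / h⌋) < h * 2 := by linarith
  have d2 : h * ((⌊y / h⌋ : ℝ) - ⌊x / h⌋) < h * 2 := by linarith
  have d1 := lt_of_mul_lt_mul_left d1 hh.le
  have d2 := lt_of_mul_lt_mul_left d2 hh.le
  norm_cast at d1 d2
  rw [abs_le]; constructor <;> omega

lemma fl_near {h : ℝ} (hh : 0 < h) (x : ℝ × ℝ) : ‖h • toR (fl h x) - x‖ ≤ h := by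
  obtain ⟨a1, a2⟩ := floor_near (x := x.1) hh
  obtain ⟨b1, b2⟩ := floor_near (x := x.2) hh
  rw [norm_le_iff2, abs_le, abs_le]
  simp only [toR, fl, Prod.fst_sub, Prod.snd_sub, Prod.smul_fst, Prod.smul_snd, smul_eq_mul]
  refine ⟨⟨?_, ?_⟩, ?_, ?_⟩ <;> linarith

lemma near_two {h : ℝ} (hh : 0 < h) (x : ℝ × ℝ) (z : ℤ × ℤ) (h1 : |z.1 - (fl h x).1| ≤ 1)
    (h2 : |z.2 - (fl h x).2| ≤ 1) : ‖h • toR z - x‖ ≤ 2 * h := by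
  have h3 : ‖toR z - toR (fl h x)‖ ≤ 1 := by
    rw [norm_le_iff2]
    simp only [toR, Prod.fst_sub, Prod.snd_sub]
    exact ⟨by exact_mod_cast h1, by exact_mod_cast h2⟩
  have h4 := norm_add_le (h • (toR z - toR (fl h x))) (h • toR (fl h x) - x)
  rw [smul_sub, sub_add_sub_cancel, ← smul_sub, norm_smul, Real.norm_eq_abs, abs_of_pos hh] at h4
  have := fl_near hh x
  nlinarith

lemma arc_walk {A : Set (ℝ × ℝ)} {x y : ℝ × ℝ} (hA : IsArc A x y) {h : ℝ} (hh : 0 < h) :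
    ∃ W : gridG.Walk (fl h x) (fl h y), ∀ z ∈ W.support, ∃ p ∈ A, ‖h • toR z - p‖ ≤ 2 * h := by
  obtain ⟨f, hf, rfl, rfl, rfl⟩ := hA
  have hu := isCompact_Icc.uniformContinuousOn_of_continuous hf
  rw [Metric.uniformContinuousOn_iff] at hu
  obtain ⟨δ, hδ, hu⟩ := hu h hh
  obtain ⟨n, hn⟩ := exists_nat_one_div_lt hδ
  have hn0 : (0 : ℝ) < n + 1 := by positivity
  have hmem : ∀ i : ℕ, i ≤ n + 1 → (i : ℝ) / (n + 1) ∈ Set.Icc (0 : ℝ) 1 := by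
    intro i hi
    have : (i : ℝ) ≤ n + 1 := by exact_mod_cast hi
    exact ⟨by positivity, (div_le_one hn0).2 this⟩
  obtain ⟨W, hW⟩ := seq_walk (fun i => fl h (f ((i : ℝ) / (n + 1)))) (n + 1) (fun i hi => by
    have := hu _ (hmem i hi.le) _ (hmem (i + 1) hi) (by
      rw [Real.dist_eq, ← sub_div, abs_div, abs_of_pos hn0]
      push_cast
      simpa using hn)
    rw [dist_eq_norm, norm_lt_iff2] at this
    exact ⟨floor_step hh this.1, floor_step hh this.2⟩)
  have e0 : fl h (f ((0 : ℕ) / ((n : ℝ) + 1))) = fl h (f 0) := by simp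
  have e1 : fl h (f ((n + 1 : ℕ) / ((n : ℝ) + 1))) = fl h (f 1) := by
    push_cast; rw [div_self hn0.ne']
  refine ⟨W.copy e0 e1, fun z hz => ?_⟩
  rw [SimpleGraph.Walk.support_copy] at hz
  obtain ⟨i, hi, h1, h2⟩ := hW z hz
  exact ⟨_, ⟨_, hmem i hi, rfl⟩, near_two hh _ z h1 h2⟩

lemma IsArc.isCompact {A : Set (ℝ × ℝ)} {x y : ℝ × ℝ} (hA : IsArc A x y) : IsCompact A := by
  obtain ⟨f, hf, rfl, -, -⟩ := hA
  exact isCompact_Icc.image_of_continuousOn hf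

lemma unif_eps {ι : Type*} [Finite ι] {P : ι → ℝ → Prop} (h : ∀ i, ∃ ε > 0, P i ε)
    (hm : ∀ i ε ε', ε' ≤ ε → P i ε → P i ε') : ∃ ε > 0, ∀ i, P i ε := by
  choose ε hε hP using h
  cases nonempty_fintype ι
  by_cases hn : Nonempty ι
  · refine ⟨univ.inf' univ_nonempty ε, ?_, fun i => hm i _ _ (Finset.inf'_le _ (mem_univ i)) (hP i)⟩
    rw [gt_iff_lt, Finset.lt_inf'_iff]
    exact fun i _ => hε i
  · exact ⟨1, one_pos, fun i => absurd ⟨i⟩ hn⟩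

lemma sep_eps {K L : Set (ℝ × ℝ)} (hK : IsCompact K) (hL : IsClosed L) (hd : Disjoint K L) :
    ∃ ε > 0, ∀ x ∈ K, ∀ y ∈ L, ε ≤ ‖x - y‖ := by
  obtain ⟨δ, hδ, h⟩ := hd.exists_thickenings hK hL
  refine ⟨δ, hδ, fun x hx y hy => ?_⟩
  by_contra! hlt
  have h5 : y ∉ Metric.thickening δ K :=
    fun h6 => Set.disjoint_left.1 h h6 (Metric.self_subset_thickening hδ _ hy)
  apply h5
  rw [Metric.mem_thickening_iff]
  exact ⟨x, hx, by rwa [dist_comm, dist_eq_norm]⟩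


theorem discretize {V : Type} [Fintype V] {G : SimpleGraph V} (D : G.Drawing) :
    ∃ S : GSys G, ∀ e f, e ≠ f → touch S.Z e f → (D.crossSet e f).Nonempty := by
  have hfin : Finite G.edgeSet := inferInstance
  choose src dst hsd harc using D.arc_isArc
  have hcomp : ∀ e, IsCompact (D.arc e) := fun e => (harc e).isCompact
  obtain ⟨ρ1, hρ1, hsep1⟩ := unif_eps (ι := V × V)
    (P := fun q ε => q.1 ≠ q.2 → 10 * ε ≤ ‖D.pt q.1 - D.pt q.2‖) (fun q => by
      by_cases hq : q.1 = q.2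
      · exact ⟨1, one_pos, fun h => absurd hq h⟩
      · have : 0 < ‖D.pt q.1 - D.pt q.2‖ := norm_pos_iff.2 (sub_ne_zero.2 fun h => hq (D.pt_inj h))
        exact ⟨‖D.pt q.1 - D.pt q.2‖ / 10, by positivity, fun _ => by linarith⟩)
    (fun q ε ε' h1 h2 h3 => by linarith [h2 h3])
  obtain ⟨ρ2, hρ2, hsep2⟩ := unif_eps (ι := G.edgeSet × V)
    (P := fun q ε => q.2 ∉ (q.1 : Sym2 V) → ∀ x ∈ D.arc q.1, 3 * ε ≤ ‖x - D.pt q.2‖) (fun q => by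
      by_cases hq : q.2 ∈ (q.1 : Sym2 V)
      · exact ⟨1, one_pos, fun h => absurd hq h⟩
      · obtain ⟨ε, hε, h⟩ := sep_eps (hcomp q.1) (isClosed_singleton (x := D.pt q.2))
          (Set.disjoint_singleton_right.2 fun h => hq (D.arc_vertex _ _ h))
        exact ⟨ε / 3, by positivity, fun _ x hx => by linarith [h x hx _ rfl]⟩)
    (fun q ε ε' h1 h2 h3 x hx => by linarith [h2 h3 x hx])
  let ρ := min ρ1 ρ2
  have hρ : 0 < ρ := lt_min hρ1 hρ2
  have hsep : ∀ u w, u ≠ w → 10 * ρ ≤ ‖D.pt u - D.pt w‖ := fun u w h => by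
    have := hsep1 (u, w) h
    have h2 : ρ ≤ ρ1 := min_le_left _ _
    simp only at this
    linarith
  have hoff : ∀ (e : G.edgeSet) (w : V), w ∉ (e : Sym2 V) → ∀ x ∈ D.arc e, 3 * ρ ≤ ‖x - D.pt w‖ := fun e w h x hx => by
    have := hsep2 (e, w) h x hx
    have h2 : ρ ≤ ρ2 := min_le_right _ _
    simp only at this
    linarith
  obtain ⟨η, hη, hcr⟩ := unif_eps (ι := G.edgeSet × G.edgeSet)
    (P := fun q ε => ¬ (D.crossSet q.1 q.2).Nonempty → ∀ x ∈ D.arc q.1, ∀ y ∈ D.arc q.2,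
      (∀ w, ρ ≤ ‖x - D.pt w‖) → ε ≤ ‖x - y‖) (fun q => by
      by_cases hq : (D.crossSet q.1 q.2).Nonempty
      · exact ⟨1, one_pos, fun h => absurd hq h⟩
      · have hcl : IsClosed {x : ℝ × ℝ | ∀ w, ρ ≤ ‖x - D.pt w‖} := by
          rw [Set.setOf_forall]
          exact isClosed_iInter fun w => isClosed_le continuous_const (by fun_prop)
        obtain ⟨ε, hε, h⟩ := sep_eps ((hcomp q.1).inter_right hcl) (hcomp q.2).isClosed
          (Set.disjoint_left.2 (by
            rintro x ⟨h1, h2⟩ h3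
            apply hq
            refine ⟨x, ⟨h1, h3⟩, ?_⟩
            rintro ⟨w, rfl, -⟩
            have := h2 w
            simp only [sub_self, norm_zero] at this
            linarith))
        exact ⟨ε, hε, fun _ x hx y hy hw => h x ⟨hx, hw⟩ y hy⟩)
    (fun q ε ε' h1 h2 h3 x hx y hy hw => h1.trans (h2 h3 x hx y hy hw))
  let h := min (ρ / 8) (η / 8)
  have hh : 0 < h := lt_min (by positivity) (by positivity)
  have hhρ : h ≤ ρ / 8 := min_le_left _ _
  have hhη : h ≤ η / 8 := min_le_right _ _
  let m := ⌈2 * ρ / h⌉₊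
  have hm1 : 2 * ρ ≤ m * h := by
    have := Nat.le_ceil (2 * ρ / h)
    rwa [div_le_iff₀ hh] at this
  have hm2 : m * h < 2 * ρ + h := by
    have := Nat.ceil_lt_add_one (a := 2 * ρ / h) (by positivity)
    have h2 := mul_lt_mul_of_pos_right this hh
    rwa [add_mul, div_mul_cancel₀ _ hh.ne', one_mul] at h2
  let ctr : V → ℤ × ℤ := fun w => fl h (D.pt w)
  have hctr : ∀ w, ‖h • toR (ctr w) - D.pt w‖ ≤ h := fun w => fl_near hh _
  have F1 : ∀ z x w, ‖h • toR z - x‖ ≤ 2 * h → inBox m (ctr w) z → ‖x - D.pt w‖ < 3 * ρ := by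
    intro z x w h1 h2
    have h3 := inBox_norm h2
    have h4 : ‖h • (toR z - toR (ctr w))‖ ≤ h * m := by
      rw [norm_smul, Real.norm_eq_abs, abs_of_pos hh]; gcongr
    have h5 : x - D.pt w = -(h • toR z - x) + (h • (toR z - toR (ctr w)) +
      (h • toR (ctr w) - D.pt w)) := by rw [smul_sub]; abel
    have h6 := norm_add_le (-(h • toR z - x)) (h • (toR z - toR (ctr w)) +
      (h • toR (ctr w) - D.pt w))
    have h7 := norm_add_le (h • (toR z - toR (ctr w))) (h • toR (ctr w) - D.pt w)
    rw [norm_neg, ← h5] at h6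
    have := hctr w
    linarith
  have F2 : ∀ z x w, ‖h • toR z - x‖ ≤ 2 * h → ¬ inBox m (ctr w) z → ρ ≤ ‖x - D.pt w‖ := by
    intro z x w h1 h2
    have h3 := not_inBox_norm h2
    have h4 : h * (m + 1) ≤ ‖h • (toR z - toR (ctr w))‖ := by
      rw [norm_smul, Real.norm_eq_abs, abs_of_pos hh]; gcongr
    have h5 : h • (toR z - toR (ctr w)) = (h • toR z - x) + ((x - D.pt w) -
      (h • toR (ctr w) - D.pt w)) := by rw [smul_sub]; abel
    have h6 := norm_add_le (h • toR z - x) ((x - D.pt w) - (h • toR (ctr w) - D.pt w))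
    have h7 := norm_sub_le (x - D.pt w) (h • toR (ctr w) - D.pt w)
    rw [← h5] at h6
    have := hctr w
    linarith
  have hcsep : ∀ u w, u ≠ w → ¬ inBox (2 * m + 1) (ctr u) (ctr w) := by
    intro u w huw hb
    have h1 := inBox_norm hb
    have h2 := hsep w u huw.symm
    have h4 : ‖h • (toR (ctr w) - toR (ctr u))‖ ≤ h * ((2 * m + 1 : ℕ) : ℝ) := by
      rw [norm_smul, Real.norm_eq_abs, abs_of_pos hh]; gcongr
    have h5 : D.pt w - D.pt u = (h • toR (ctr u) - D.pt u) + (h • (toR (ctr w) - toR (ctr u)) -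
      (h • toR (ctr w) - D.pt w)) := by rw [smul_sub]; abel
    have h6 := norm_add_le (h • toR (ctr u) - D.pt u) (h • (toR (ctr w) - toR (ctr u)) -
      (h • toR (ctr w) - D.pt w))
    have h7 := norm_sub_le (h • (toR (ctr w) - toR (ctr u))) (h • toR (ctr w) - D.pt w)
    rw [← h5] at h6
    have := hctr w
    have := hctr u
    push_cast at h4
    linarith
  have hself : ∀ w, inBox m (ctr w) (ctr w) := fun w => by
    refine ⟨?_, ?_, ?_, ?_⟩ <;> omega
  have hne : ∀ e, src e ≠ dst e := fun e => by
    have := e.2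
    rw [hsd e, SimpleGraph.mem_edgeSet] at this
    exact this.ne
  have hW : ∀ e, ∃ z0 a b z1, inBox m (ctr (src e)) z0 ∧ inBox m (ctr (dst e)) z1 ∧
      gridG.Adj z0 a ∧ gridG.Adj b z1 ∧ ∃ Z : gridG.Walk a b, ∀ z ∈ Z.support,
        (∃ p ∈ D.arc e, ‖h • toR z - p‖ ≤ 2 * h) ∧ ∀ w, ¬ inBox m (ctr w) z := by
    intro e
    obtain ⟨W, hW⟩ := arc_walk (harc e) hh
    have hs := hcsep _ _ (hne e)
    obtain ⟨z0, a, b, z1, h1, h2, h3, h4, Z, hZ⟩ := cut_walk {z | inBox m (ctr (src e)) z}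
      {z | inBox m (ctr (dst e)) z} W (hself _) (hself _) (by
        intro z hz hz'
        apply hs
        simp only [inBox, Set.mem_setOf_eq] at hz hz' ⊢
        push_cast
        refine ⟨?_, ?_, ?_, ?_⟩ <;> omega) (by
        intro z hz w hw hzw
        apply hs
        obtain ⟨x, y⟩ := z
        rcases gridG_cases hzw with rfl | rfl | rfl | rfl <;>
        · simp only [inBox, Set.mem_setOf_eq] at hz hw ⊢
          push_cast
          refine ⟨?_, ?_, ?_, ?_⟩ <;> omega)
    refine ⟨z0, a, b, z1, h1, h2, h3, h4, Z, fun z hz => ?_⟩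
    obtain ⟨g1, g2, g3⟩ := hZ z hz
    obtain ⟨p, hp, hpz⟩ := hW z g1
    refine ⟨⟨p, hp, hpz⟩, fun w hw => ?_⟩
    by_cases hwe : w ∈ (e : Sym2 V)
    · rw [hsd e, Sym2.mem_iff] at hwe
      rcases hwe with rfl | rfl
      · exact g2 hw
      · exact g3 hw
    · have := hoff e w hwe p hp
      have := F1 z p w hpz hw
      linarith
  choose z0 a b z1 w0 w1 w2 w3 Z hZ using hW
  refine ⟨⟨m, ctr, hcsep, src, dst, hsd, z0, z1, a, b, w0, w1, w2, w3, Z,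
    fun e w x hx => (hZ e x hx).2 w⟩, ?_⟩
  rintro e f hef ⟨z, hz1, hz2⟩
  obtain ⟨⟨p, hp, hpz⟩, hb⟩ := hZ e z hz1
  obtain ⟨⟨q, hq, hqz⟩, -⟩ := hZ f z hz2
  by_contra hcon
  have h1 := hcr (e, f) hcon p hp q hq (fun w => F2 z p w hpz (hb w))
  have h2 := norm_sub_le (h • toR z - q) (h • toR z - p)
  rw [sub_sub_sub_cancel_left] at h2
  linarith

theorem main' :
    ∃ C : ℝ, 0 < C ∧
      ∀ (V : Type) [Fintype V] (G : SimpleGraph V),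
        2 ≤ G.pcr →
        (G.cr : ℝ) ≤ C * (G.pcr : ℝ) ^ ((3 : ℝ) / 2) * (Real.log (G.pcr)) ^ 2 := by
  refine ⟨200000, by norm_num, fun V _ G hp => ?_⟩
  have hne : { k : ℕ | ∃ D : G.Drawing, D.crossingPairCount = k }.Nonempty := by
    by_contra hcon
    rw [Set.not_nonempty_iff_eq_empty] at hcon
    rw [SimpleGraph.pcr, hcon, Nat.sInf_empty] at hp
    omega
  obtain ⟨D, hD⟩ := Nat.sInf_mem hne
  obtain ⟨S, hS⟩ := discretize D
  exact assemble S D hS hp hD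

/-- **Crossing number versus pair-crossing number.** There is a constant `C > 0` such
that every graph `G` with pair-crossing number `p = pcr(G) ≥ 2` satisfies
`cr(G) ≤ C·p^{3/2}·(log p)²`. -/
theorem cr_le_pcr_pow :
    ∃ C : ℝ, 0 < C ∧
      ∀ (V : Type) [Fintype V] (G : SimpleGraph V),
        2 ≤ G.pcr →
        (G.cr : ℝ) ≤ C * (G.pcr : ℝ) ^ ((3 : ℝ) / 2) * (Real.log (G.pcr)) ^ 2 :=
  main'
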